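/- Assume there is a constant C > 0 such that the standard Gaussian measure γ on ℝ satisfies the logarithmic Sobolev inequality Ent_γ(u) ≤ C ∫ (u')²/u dγ for every smooth positive probability density u with respect to γ with finite Fisher information. Then for every smooth positive probability density f with respect to γ with finite entropy and finite Fisher information, and every T ≥ 0: T₂²(f γ, (P_T f) γ) ≤ 4C · Ent_γ(f). -/

import Mathlib

open MeasureTheory Real Filter
open scoped ENNReal Topology

noncomputable section

/-- Density of the standard Gaussian measure on ℝ. -/
def gaussD (x : ℝ) : ℝ := (Real.sqrt (2 * Real.pi))⁻¹ * Real.exp (-x ^ 2 / 2)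

/-- The standard Gaussian measure on ℝ. -/
def gauss : Measure ℝ := volume.withDensity fun x => ENNReal.ofReal (gaussD x)

/-- The Ornstein–Uhlenbeck semigroup. -/
def OU (t : ℝ) (f : ℝ → ℝ) (x : ℝ) : ℝ :=
  ∫ y, f (Real.exp (-t) * x + Real.sqrt (1 - Real.exp (-2 * t)) * y) ∂gauss

/-- Entropy with respect to the Gaussian measure. -/
def entG (u : ℝ → ℝ) : ℝ := ∫ x, u x * Real.log (u x) ∂gauss

/-- Smooth positive probability density with respect to the Gaussian measure. -/
def IsDensityG (u : ℝ → ℝ) : Prop :=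
  (∀ x, 0 < u x) ∧ ContDiff ℝ (⊤ : ℕ∞) u ∧ Integrable u gauss ∧ ∫ x, u x ∂gauss = 1

/-- Weak continuity equation ∂ₛρₛ + Lhₛ = 0 for the Ornstein–Uhlenbeck generator. -/
def ContinuityEqnG (ρ h : ℝ → ℝ → ℝ) : Prop :=
  ∀ ψ : ℝ → ℝ, ContDiff ℝ (⊤ : ℕ∞) ψ → HasCompactSupport ψ →
    IntervalIntegrable (fun s => ∫ x, deriv (h s) x * deriv ψ x ∂gauss) volume 0 1 ∧
    ∀ s ∈ Set.Icc (0:ℝ) 1,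
      ∫ x, ρ s x * ψ x ∂gauss =
        (∫ x, ρ 0 x * ψ x ∂gauss) +
          ∫ u in (0:ℝ)..s, ∫ x, deriv (h u) x * deriv ψ x ∂gauss

/-- Admissible path between two densities with respect to the Gaussian measure. -/
def IsAdmissiblePathG (f g : ℝ → ℝ) (ρ h : ℝ → ℝ → ℝ) : Prop :=
  (∀ s ∈ Set.Icc (0:ℝ) 1, IsDensityG (ρ s)) ∧
  (∀ s ∈ Set.Icc (0:ℝ) 1, ContDiff ℝ (⊤ : ℕ∞) (h s)) ∧
  ρ 0 = f ∧ ρ 1 = g ∧ ContinuityEqnG ρ h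

/-- Squared Markov transportation distance for the Ornstein–Uhlenbeck semigroup. -/
def T2sqG (f g : ℝ → ℝ) : ℝ≥0∞ :=
  sInf {r | ∃ ρ h : ℝ → ℝ → ℝ, IsAdmissiblePathG f g ρ h ∧
    r = ∫⁻ s in Set.Icc (0:ℝ) 1, ∫⁻ x, ENNReal.ofReal ((deriv (h s) x) ^ 2 / ρ s x) ∂gauss}

open ProbabilityTheory InformationTheory

lemma gaussD_eq (x : ℝ) : gaussD x = gaussianPDFReal 0 1 x := by
  simp [gaussD, gaussianPDFReal]

lemma gauss_eq : gauss = gaussianReal 0 1 := by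
  rw [gaussianReal_of_var_ne_zero 0 one_ne_zero, gauss]
  congr 1
  ext x
  rw [gaussD_eq, gaussianPDF]

instance : IsProbabilityMeasure gauss := gauss_eq ▸ inferInstance

lemma gaussD_pos (x : ℝ) : 0 < gaussD x := by
  rw [gaussD_eq]; exact gaussianPDFReal_pos 0 1 x one_ne_zero

lemma continuous_gaussD : Continuous gaussD := by
  unfold gaussD; fun_prop

lemma hasDerivAt_gaussD (x : ℝ) : HasDerivAt gaussD (-x * gaussD x) x := by
  have h : HasDerivAt (fun x : ℝ => -x ^ 2 / 2) (-x) x := by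
    have := ((hasDerivAt_pow 2 x).neg).div_const 2
    refine this.congr_deriv ?_
    norm_num
    ring
  refine (h.exp.const_mul (Real.sqrt (2 * Real.pi))⁻¹).congr_deriv ?_
  simp only [gaussD]; ring

lemma integral_gauss (f : ℝ → ℝ) : ∫ x, f x ∂gauss = ∫ x, gaussD x * f x := by
  rw [gauss, integral_withDensity_eq_integral_toReal_smul
    continuous_gaussD.measurable.ennreal_ofReal (Eventually.of_forall fun _ => ENNReal.ofReal_lt_top)]
  simp [ENNReal.toReal_ofReal (gaussD_pos _).le]

lemma integrable_gauss_iff (f : ℝ → ℝ) :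
    Integrable f gauss ↔ Integrable (fun x => gaussD x * f x) := by
  rw [gauss, integrable_withDensity_iff_integrable_smul'
    continuous_gaussD.measurable.ennreal_ofReal (Eventually.of_forall fun _ => ENNReal.ofReal_lt_top)]
  simp [ENNReal.toReal_ofReal (gaussD_pos _).le]

/-- Gaussian integration by parts. -/
lemma integral_deriv_sub_mul_eq_zero {u u' : ℝ → ℝ} (hu : ∀ x, HasDerivAt u (u' x) x)
    (hi : Integrable u gauss) (hi' : Integrable (fun x => u' x - x * u x) gauss) :
    ∫ x, (u' x - x * u x) ∂gauss = 0 := by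
  rw [integral_gauss]
  rw [integrable_gauss_iff] at hi hi'
  refine integral_eq_zero_of_hasDerivAt_of_integrable (f := fun x => gaussD x * u x)
    (fun x => ?_) hi' hi
  refine ((hasDerivAt_gaussD x).mul (hu x)).congr_deriv ?_
  ring

/-- Average of `f` over a Gaussian variable of mean `a * x` and standard deviation `σ`. -/
def mehler (a σ : ℝ) (f : ℝ → ℝ) (x : ℝ) : ℝ := ∫ y, f (a * x + σ * y) ∂gauss

/-- The Mehler kernel with respect to the Gaussian measure. -/
def mehlerKernel (a σ x z : ℝ) : ℝ :=
  σ⁻¹ * Real.exp (x ^ 2 / 2) * Real.exp (-(a * z - x) ^ 2 / (2 * σ ^ 2))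

lemma mehlerKernel_pos {a σ : ℝ} (hσ : 0 < σ) (x z : ℝ) : 0 < mehlerKernel a σ x z := by
  unfold mehlerKernel; positivity

lemma mehlerKernel_le {a σ : ℝ} (hσ : 0 < σ) (x z : ℝ) :
    mehlerKernel a σ x z ≤ σ⁻¹ * Real.exp (x ^ 2 / 2) := by
  unfold mehlerKernel
  refine mul_le_of_le_one_right (by positivity) ?_
  rw [Real.exp_le_one_iff]
  rw [neg_div, neg_nonpos]
  positivity

lemma continuous_mehlerKernel (a σ : ℝ) :
    Continuous fun p : ℝ × ℝ => mehlerKernel a σ p.1 p.2 := by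
  unfold mehlerKernel; fun_prop

lemma continuous_mehlerKernel_right (a σ x : ℝ) :
    Continuous fun z : ℝ => mehlerKernel a σ x z := by
  unfold mehlerKernel; fun_prop

lemma mehlerKernel_symm {a σ : ℝ} (hσ : 0 < σ) (h : a ^ 2 + σ ^ 2 = 1) (x z : ℝ) :
    mehlerKernel a σ x z = mehlerKernel a σ z x := by
  unfold mehlerKernel
  rw [mul_assoc, mul_assoc, ← Real.exp_add, ← Real.exp_add]
  congr 2
  field_simp
  have : a ^ 2 = 1 - σ ^ 2 := by linarith
  ring_nf
  rw [this]; ring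

lemma map_affine_gauss {a σ : ℝ} (hσ : 0 < σ) (h : a ^ 2 + σ ^ 2 = 1) (x : ℝ) :
    gauss.map (fun y => a * x + σ * y) =
      gauss.withDensity fun z => ENNReal.ofReal (mehlerKernel a σ x z) := by
  have h1 : gauss.map (fun y => a * x + σ * y) =
      gaussianReal (a * x) (NNReal.mk (σ ^ 2) (sq_nonneg _)) := by
    have : (fun y => a * x + σ * y) = (fun y => a * x + y) ∘ (fun y => σ * y) := rfl
    rw [this, ← Measure.map_map (by fun_prop) (by fun_prop), gauss_eq, gaussianReal_map_const_mul,
      gaussianReal_map_const_add]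
    simp
  have hne : (NNReal.mk (σ ^ 2) (sq_nonneg _)) ≠ 0 := by
    intro h0
    have := congrArg NNReal.toReal h0
    simp at this
    exact hσ.ne' this
  rw [h1, gaussianReal_of_var_ne_zero _ hne, gauss, ← withDensity_mul _
    continuous_gaussD.measurable.ennreal_ofReal
    (continuous_mehlerKernel_right a σ x).measurable.ennreal_ofReal]
  congr 1
  ext z
  simp only [gaussianPDF, Pi.mul_apply]
  rw [← ENNReal.ofReal_mul (gaussD_pos z).le]
  congr 1
  simp only [gaussianPDFReal, gaussD, mehlerKernel, NNReal.coe_mk]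
  rw [Real.sqrt_mul (by positivity), Real.sqrt_sq hσ.le]
  have : Real.exp (-(z - a * x) ^ 2 / (2 * σ ^ 2)) = Real.exp (-z ^ 2 / 2) *
      (Real.exp (x ^ 2 / 2) * Real.exp (-(a * z - x) ^ 2 / (2 * σ ^ 2))) := by
    rw [← Real.exp_add, ← Real.exp_add]
    congr 1
    field_simp
    have : a ^ 2 = 1 - σ ^ 2 := by linarith
    ring_nf
    rw [this]; ring
  rw [this]
  ring

lemma integrable_mul_mehlerKernel {a σ : ℝ} (hσ : 0 < σ) {f : ℝ → ℝ}
    (hf : Integrable f gauss) (x : ℝ) : Integrable (fun z => mehlerKernel a σ x z * f z) gauss := by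
  refine hf.bdd_mul (c := σ⁻¹ * Real.exp (x ^ 2 / 2)) ?_ ?_
  · exact (continuous_mehlerKernel_right a σ x).aestronglyMeasurable
  · refine Eventually.of_forall fun z => ?_
    rw [Real.norm_eq_abs, abs_of_pos (mehlerKernel_pos hσ x z)]
    exact mehlerKernel_le hσ x z

lemma integrable_comp_affine {a σ : ℝ} (hσ : 0 < σ) (h : a ^ 2 + σ ^ 2 = 1) {f : ℝ → ℝ}
    (hf : Integrable f gauss) (x : ℝ) : Integrable (fun y => f (a * x + σ * y)) gauss := by
  have : Integrable f (gauss.map (fun y => a * x + σ * y)) := by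
    rw [map_affine_gauss hσ h, integrable_withDensity_iff_integrable_smul' (continuous_mehlerKernel_right a σ x).measurable.ennreal_ofReal
      (Eventually.of_forall fun _ => ENNReal.ofReal_lt_top)]
    simpa [ENNReal.toReal_ofReal (mehlerKernel_pos hσ _ _).le] using
      integrable_mul_mehlerKernel hσ hf x
  exact this.comp_measurable (by fun_prop)

lemma mehler_eq_integral_kernel {a σ : ℝ} (hσ : 0 < σ) (h : a ^ 2 + σ ^ 2 = 1) {f : ℝ → ℝ}
    (hf : Integrable f gauss) (x : ℝ) :
    mehler a σ f x = ∫ z, mehlerKernel a σ x z * f z ∂gauss := by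
  have : AEStronglyMeasurable f (gauss.map (fun y => a * x + σ * y)) := by
    rw [map_affine_gauss hσ h]
    exact hf.1.mono_ac (withDensity_absolutelyContinuous _ _)
  rw [mehler, ← integral_map (f := f) (by fun_prop) this, map_affine_gauss hσ h,
    integral_withDensity_eq_integral_toReal_smul (continuous_mehlerKernel_right a σ x).measurable.ennreal_ofReal
      (Eventually.of_forall fun _ => ENNReal.ofReal_lt_top)]
  simp [ENNReal.toReal_ofReal (mehlerKernel_pos hσ _ _).le]

lemma map_linear_prod_gauss {α β c : ℝ} (h : α ^ 2 + β ^ 2 = c ^ 2) :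
    (gauss.prod gauss).map (fun p => α * p.1 + β * p.2) = gauss.map (fun y => c * y) := by
  have : (fun p : ℝ × ℝ => α * p.1 + β * p.2) =
      (fun p => p.1 + p.2) ∘ Prod.map (fun x => α * x) (fun x => β * x) := rfl
  rw [this, ← Measure.map_map (by fun_prop) (by fun_prop), ← Measure.map_prod_map _ _
    (by fun_prop) (by fun_prop)]
  change Measure.conv _ _ = _
  rw [gauss_eq, gaussianReal_map_const_mul, gaussianReal_map_const_mul, gaussianReal_map_const_mul,
    gaussianReal_conv_gaussianReal]
  congr 1
  · simp
  · ext; simp [h]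

lemma map_rotation_gauss {a σ : ℝ} (h : a ^ 2 + σ ^ 2 = 1) :
    (gauss.prod gauss).map (fun p => a * p.1 + σ * p.2) = gauss := by
  rw [map_linear_prod_gauss (c := 1) (by rw [h]; norm_num)]
  simp

lemma integrable_prod_affine {a σ : ℝ} (h : a ^ 2 + σ ^ 2 = 1) {f : ℝ → ℝ}
    (hf : Integrable f gauss) :
    Integrable (fun p : ℝ × ℝ => f (a * p.1 + σ * p.2)) (gauss.prod gauss) := by
  rw [← map_rotation_gauss h] at hf
  exact hf.comp_measurable (by fun_prop)

lemma integrable_mehler {a σ : ℝ} (h : a ^ 2 + σ ^ 2 = 1) {f : ℝ → ℝ}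
    (hf : Integrable f gauss) : Integrable (mehler a σ f) gauss :=
  (integrable_prod_affine h hf).integral_prod_left

lemma integral_mehler {a σ : ℝ} (h : a ^ 2 + σ ^ 2 = 1) {f : ℝ → ℝ}
    (hf : Integrable f gauss) : ∫ x, mehler a σ f x ∂gauss = ∫ x, f x ∂gauss := by
  unfold mehler
  rw [← integral_prod _ (integrable_prod_affine h hf)]
  conv_rhs => rw [← map_rotation_gauss h]
  rw [integral_map (by fun_prop)]
  rw [map_rotation_gauss h]; exact hf.1

lemma mehler_mehler {a b σ ρ c : ℝ} (hc : 0 < c) (h : (a * b) ^ 2 + c ^ 2 = 1)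
    (hσ : (a * ρ) ^ 2 + σ ^ 2 = c ^ 2) {f : ℝ → ℝ} (hf : Integrable f gauss) :
    mehler b ρ (mehler a σ f) = mehler (a * b) c f := by
  ext x
  have hi := integrable_comp_affine hc h hf x
  have hm := map_linear_prod_gauss hσ
  set F : ℝ → ℝ := fun w => f (a * b * x + w)
  have hF : Integrable F (gauss.map fun y => c * y) := by
    refine (integrable_map_equiv (MeasurableEquiv.mulLeft₀ c hc.ne') F).2 hi
  unfold mehler
  have e1 : ∀ y z, f (a * (b * x + ρ * y) + σ * z) = F (a * ρ * y + σ * z) := by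
    intro y z; simp only [F]; ring_nf
  simp_rw [e1]
  have hF2 := hF
  rw [← hm] at hF2
  rw [← integral_prod (fun p : ℝ × ℝ => F (a * ρ * p.1 + σ * p.2))
    (hF2.comp_measurable (by fun_prop)), ← integral_map (f := F) (by fun_prop) hF2.1, hm,
    integral_map (by fun_prop) hF.1]

/-- The density, with respect to the Gaussian measure, of the measure whose moment generating
function describes `mehler a σ f`. -/
def mehlerWeight (a σ : ℝ) (f : ℝ → ℝ) : Measure ℝ :=
  gauss.withDensity fun z => ENNReal.ofReal (f z * Real.exp (-(a * z) ^ 2 / (2 * σ ^ 2)))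

lemma mehlerKernel_eq_exp {a σ : ℝ} (hσ : 0 < σ) (x z : ℝ) :
    mehlerKernel a σ x z = σ⁻¹ * Real.exp (x ^ 2 / 2 - x ^ 2 / (2 * σ ^ 2)) *
      (Real.exp (-(a * z) ^ 2 / (2 * σ ^ 2)) * Real.exp (a * x / σ ^ 2 * z)) := by
  unfold mehlerKernel
  rw [mul_assoc, mul_assoc, ← Real.exp_add, ← Real.exp_add, ← Real.exp_add]
  congr 2
  field_simp
  ring

lemma integral_mehlerWeight {a σ : ℝ} {f : ℝ → ℝ} (hf0 : ∀ x, 0 ≤ f x) (hm : Measurable f)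
    (w : ℝ → ℝ) : ∫ z, w z ∂(mehlerWeight a σ f) =
      ∫ z, f z * Real.exp (-(a * z) ^ 2 / (2 * σ ^ 2)) * w z ∂gauss := by
  rw [mehlerWeight, integral_withDensity_eq_integral_toReal_smul (by fun_prop)
    (Eventually.of_forall fun _ => ENNReal.ofReal_lt_top)]
  congr 1
  ext z
  rw [ENNReal.toReal_ofReal (mul_nonneg (hf0 z) (Real.exp_nonneg _)), smul_eq_mul]

lemma integrable_mehlerWeight_iff {a σ : ℝ} {f : ℝ → ℝ} (hf0 : ∀ x, 0 ≤ f x) (hm : Measurable f)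
    (w : ℝ → ℝ) : Integrable w (mehlerWeight a σ f) ↔
      Integrable (fun z => f z * Real.exp (-(a * z) ^ 2 / (2 * σ ^ 2)) * w z) gauss := by
  rw [mehlerWeight, integrable_withDensity_iff_integrable_smul' (by fun_prop)
    (Eventually.of_forall fun _ => ENNReal.ofReal_lt_top)]
  refine integrable_congr (Eventually.of_forall fun z => ?_)
  simp only
  rw [ENNReal.toReal_ofReal (mul_nonneg (hf0 z) (Real.exp_nonneg _)), smul_eq_mul]

lemma integrableExpSet_mehlerWeight {a σ : ℝ} (ha : 0 < a) (hσ : 0 < σ) {f : ℝ → ℝ}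
    (hf0 : ∀ x, 0 ≤ f x) (hm : Measurable f) (hf : Integrable f gauss) :
    integrableExpSet id (mehlerWeight a σ f) = Set.univ := by
  ext t
  simp only [integrableExpSet, Set.mem_ofPred_eq, Set.mem_univ, iff_true, id]
  rw [integrable_mehlerWeight_iff hf0 hm]
  set x := t * σ ^ 2 / a
  refine ((integrable_mul_mehlerKernel (a := a) hσ hf x).const_mul
    (σ⁻¹ * Real.exp (x ^ 2 / 2 - x ^ 2 / (2 * σ ^ 2)))⁻¹).congr
    (Eventually.of_forall fun z => ?_)
  have : a * x / σ ^ 2 = t := by simp only [x]; field_simp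
  simp only
  rw [mehlerKernel_eq_exp hσ, this]
  field_simp

lemma mehler_eq_mgf {a σ : ℝ} (hσ : 0 < σ) (h : a ^ 2 + σ ^ 2 = 1) {f : ℝ → ℝ}
    (hf0 : ∀ x, 0 ≤ f x) (hm : Measurable f) (hf : Integrable f gauss) (x : ℝ) :
    mehler a σ f x = σ⁻¹ * Real.exp (x ^ 2 / 2 - x ^ 2 / (2 * σ ^ 2)) *
      mgf id (mehlerWeight a σ f) (a * x / σ ^ 2) := by
  rw [mehler_eq_integral_kernel hσ h hf, mgf, integral_mehlerWeight hf0 hm, ← integral_const_mul]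
  congr 1
  ext z
  rw [mehlerKernel_eq_exp hσ]
  simp only [id]
  ring

lemma contDiff_mehler {a σ : ℝ} (ha : 0 < a) (hσ : 0 < σ) (h : a ^ 2 + σ ^ 2 = 1) {f : ℝ → ℝ}
    (hf0 : ∀ x, 0 ≤ f x) (hm : Measurable f) (hf : Integrable f gauss) :
    ContDiff ℝ (⊤ : ℕ∞) (mehler a σ f) := by
  have hmgf : ContDiff ℝ (⊤ : ℕ∞) (mgf id (mehlerWeight a σ f)) := by
    have := analyticOnNhd_mgf (X := id) (μ := mehlerWeight a σ f)
    rw [integrableExpSet_mehlerWeight ha hσ hf0 hm hf, interior_univ] at this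
    exact contDiff_iff_contDiffAt.2 fun x => (this x trivial).contDiffAt
  rw [funext (mehler_eq_mgf hσ h hf0 hm hf)]
  refine ContDiff.mul (by fun_prop) (hmgf.comp (by fun_prop))

lemma abs_mul_exp_neg_sq_le {σ : ℝ} (hσ : 0 < σ) (u : ℝ) :
    |u| * Real.exp (-u ^ 2 / (2 * σ ^ 2)) ≤ σ := by
  have h1 : |u| ≤ σ * Real.exp (u ^ 2 / (2 * σ ^ 2)) := by
    have h2 := Real.add_one_le_exp (u ^ 2 / (2 * σ ^ 2))
    have h3 : |u| ≤ σ * (u ^ 2 / (2 * σ ^ 2) + 1) := by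
      have : σ * (u ^ 2 / (2 * σ ^ 2) + 1) - |u| = ((|u| - σ) ^ 2 + σ ^ 2) / (2 * σ) := by
        rw [← sq_abs u]; field_simp; ring
      have h4 : 0 ≤ ((|u| - σ) ^ 2 + σ ^ 2) / (2 * σ) := by positivity
      linarith
    exact h3.trans (by gcongr)
  calc |u| * Real.exp (-u ^ 2 / (2 * σ ^ 2))
      ≤ σ * Real.exp (u ^ 2 / (2 * σ ^ 2)) * Real.exp (-u ^ 2 / (2 * σ ^ 2)) := by gcongr
    _ = σ := by
      rw [mul_assoc, ← Real.exp_add, neg_div, add_neg_cancel, Real.exp_zero, mul_one]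

lemma integrable_id_mul_mehlerKernel {a σ : ℝ} (ha : 0 < a) (hσ : 0 < σ) {f : ℝ → ℝ}
    (hf : Integrable f gauss) (x : ℝ) :
    Integrable (fun z => z * mehlerKernel a σ x z * f z) gauss := by
  have hb : Integrable (fun z => (a * z - x) * mehlerKernel a σ x z * f z) gauss := by
    refine hf.bdd_mul (c := σ⁻¹ * Real.exp (x ^ 2 / 2) * σ) ?_ (Eventually.of_forall fun z => ?_)
    · exact ((by fun_prop : Continuous fun z : ℝ => a * z - x).mul
        (continuous_mehlerKernel_right a σ x)).aestronglyMeasurable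
    · rw [Real.norm_eq_abs, abs_mul, abs_of_pos (mehlerKernel_pos hσ x z), mehlerKernel]
      have := abs_mul_exp_neg_sq_le hσ (a * z - x)
      calc _ = σ⁻¹ * Real.exp (x ^ 2 / 2) *
            (|a * z - x| * Real.exp (-(a * z - x) ^ 2 / (2 * σ ^ 2))) := by ring
        _ ≤ _ := by gcongr
  refine ((hb.add ((integrable_mul_mehlerKernel (a := a) hσ hf x).const_mul x)).const_mul a⁻¹).congr
    (Eventually.of_forall fun z => ?_)
  simp only [Pi.add_apply]
  field_simp
  ring

lemma hasDerivAt_mehler_of_nonneg {a σ : ℝ} (ha : 0 < a) (hσ : 0 < σ) (h : a ^ 2 + σ ^ 2 = 1)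
    {f f' : ℝ → ℝ} (hf0 : ∀ x, 0 ≤ f x) (hd : ∀ x, HasDerivAt f (f' x) x)
    (hf : Integrable f gauss) (hf' : Integrable f' gauss) (x : ℝ) :
    HasDerivAt (mehler a σ f) (a * mehler a σ f' x) x := by
  have hm : Measurable f :=
    (continuous_iff_continuousAt.2 fun x => (hd x).continuousAt).measurable
  set s := a * x / σ ^ 2
  set c : ℝ → ℝ := fun x => σ⁻¹ * Real.exp (x ^ 2 / 2 - x ^ 2 / (2 * σ ^ 2))
  have hc : HasDerivAt c (c x * (x - x / σ ^ 2)) x := by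
    have h1 : HasDerivAt (fun x : ℝ => x ^ 2 / 2 - x ^ 2 / (2 * σ ^ 2)) (x - x / σ ^ 2) x := by
      refine (((hasDerivAt_pow 2 x).div_const 2).sub
        ((hasDerivAt_pow 2 x).div_const (2 * σ ^ 2))).congr_deriv ?_
      norm_num
      field_simp
    refine (h1.exp.const_mul σ⁻¹).congr_deriv ?_
    simp only [c]; ring
  have hs : HasDerivAt (fun x : ℝ => a * x / σ ^ 2) (a / σ ^ 2) x := by
    refine (((hasDerivAt_id x).const_mul a).div_const (σ ^ 2)).congr_deriv ?_
    simp
  have hmg := hasDerivAt_mgf (X := id) (μ := mehlerWeight a σ f) (t := s)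
    (by rw [integrableExpSet_mehlerWeight ha hσ hf0 hm hf]; simp)
  rw [funext (mehler_eq_mgf hσ h hf0 hm hf)]
  refine (hc.mul (hmg.comp x hs)).congr_deriv ?_
  have hk : ∀ z, HasDerivAt (fun z => mehlerKernel a σ x z)
      (mehlerKernel a σ x z * (-a * (a * z - x) / σ ^ 2)) z := by
    intro z
    have h1 : HasDerivAt (fun z : ℝ => -(a * z - x) ^ 2 / (2 * σ ^ 2))
        (-a * (a * z - x) / σ ^ 2) z := by
      refine ((((((hasDerivAt_id z).const_mul a).sub_const x).pow 2).neg).div_const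
        (2 * σ ^ 2)).congr_deriv ?_
      norm_num
      field_simp
    refine (h1.exp.const_mul (σ⁻¹ * Real.exp (x ^ 2 / 2))).congr_deriv ?_
    simp only [mehlerKernel]; ring
  have i1 := integrable_mul_mehlerKernel (a := a) hσ hf x
  have i2 := integrable_mul_mehlerKernel (a := a) hσ hf' x
  have i3 := integrable_id_mul_mehlerKernel ha hσ hf x
  have i4 : Integrable (fun z => mehlerKernel a σ x z * f' z +
      (a * x / σ ^ 2) * (mehlerKernel a σ x z * f z)) gauss := i2.add (i1.const_mul _)
  have e : ∀ z, mehlerKernel a σ x z * (-a * (a * z - x) / σ ^ 2) * f z +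
      mehlerKernel a σ x z * f' z - z * (mehlerKernel a σ x z * f z) =
      mehlerKernel a σ x z * f' z + (a * x / σ ^ 2) * (mehlerKernel a σ x z * f z) -
      (1 / σ ^ 2) * (z * mehlerKernel a σ x z * f z) := by
    intro z
    field_simp
    have : a ^ 2 = 1 - σ ^ 2 := by linarith
    ring_nf
    rw [this]; ring
  have ibp := integral_deriv_sub_mul_eq_zero (fun z => (hk z).mul (hd z)) i1 (by
    simp only [Pi.mul_apply]
    simp_rw [e]
    exact i4.sub (i3.const_mul _))
  simp only [Pi.mul_apply] at ibp
  simp_rw [e] at ibp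
  rw [integral_sub i4 (i3.const_mul _), integral_add i2 (i1.const_mul _),
    integral_const_mul, integral_const_mul] at ibp
  have e2 : c x * mgf id (mehlerWeight a σ f) s = ∫ z, mehlerKernel a σ x z * f z ∂gauss := by
    rw [← mehler_eq_integral_kernel hσ h hf, mehler_eq_mgf hσ h hf0 hm hf]
  have e3 : c x * ∫ z, (fun ω => id ω * Real.exp (s * id ω)) z ∂(mehlerWeight a σ f) =
      ∫ z, z * mehlerKernel a σ x z * f z ∂gauss := by
    rw [integral_mehlerWeight hf0 hm, ← integral_const_mul]
    congr 1
    ext z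
    rw [mehlerKernel_eq_exp hσ]
    simp only [id, c, s]
    ring
  rw [mehler_eq_integral_kernel hσ h hf']
  simp only [Function.comp]
  rw [← mul_assoc (c x), e3, mul_right_comm, e2]
  set A := ∫ z, mehlerKernel a σ x z * f z ∂gauss
  set B := ∫ z, z * mehlerKernel a σ x z * f z ∂gauss
  have : ∫ z, mehlerKernel a σ x z * f' z ∂gauss = 1 / σ ^ 2 * B - a * x / σ ^ 2 * A := by linarith
  rw [this]
  field_simp
  have : a ^ 2 = 1 - σ ^ 2 := by linarith
  ring_nf
  rw [this]; ring

lemma mehler_add_const {a σ : ℝ} (hσ : 0 < σ) (h : a ^ 2 + σ ^ 2 = 1)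
    {f : ℝ → ℝ} (hf : Integrable f gauss) (c : ℝ) :
    mehler a σ (fun x => f x + c) = fun x => mehler a σ f x + c := by
  ext x
  simp only [mehler]
  rw [integral_add (integrable_comp_affine hσ h hf x) (integrable_const c)]
  simp

lemma hasDerivAt_mehler {a σ : ℝ} (ha : 0 < a) (hσ : 0 < σ) (h : a ^ 2 + σ ^ 2 = 1)
    {f f' : ℝ → ℝ} {c : ℝ} (hf0 : ∀ x, c ≤ f x) (hd : ∀ x, HasDerivAt f (f' x) x)
    (hf : Integrable f gauss) (hf' : Integrable f' gauss) (x : ℝ) :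
    HasDerivAt (mehler a σ f) (a * mehler a σ f' x) x := by
  have := hasDerivAt_mehler_of_nonneg ha hσ h (f := fun x => f x + -c) (f' := f')
    (fun x => by linarith [hf0 x]) (fun x => (hd x).add_const _) (hf.add (integrable_const _)) hf' x
  rw [mehler_add_const hσ h hf] at this
  simpa using this.add_const c

lemma exp_sq_add_sqrt_sq {t : ℝ} (ht : 0 ≤ t) :
    Real.exp (-t) ^ 2 + Real.sqrt (1 - Real.exp (-2 * t)) ^ 2 = 1 := by
  have h1 : Real.exp (-2 * t) ≤ 1 := Real.exp_le_one_iff.2 (by linarith)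
  rw [Real.sq_sqrt (by linarith), ← Real.exp_nat_mul]
  rw [show ((2 : ℕ) : ℝ) * -t = -2 * t by push_cast; ring]
  ring

lemma sqrt_one_sub_exp_pos {t : ℝ} (ht : 0 < t) : 0 < Real.sqrt (1 - Real.exp (-2 * t)) := by
  have h1 : Real.exp (-2 * t) < 1 := Real.exp_lt_one_iff.2 (by linarith)
  exact Real.sqrt_pos.2 (by linarith)

lemma OU_eq_mehler (t : ℝ) (f : ℝ → ℝ) :
    OU t f = mehler (Real.exp (-t)) (Real.sqrt (1 - Real.exp (-2 * t))) f := rfl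

lemma OU_zero (f : ℝ → ℝ) : OU 0 f = f := by
  ext x; simp [OU]

lemma integrable_comp_OU {t : ℝ} (ht : 0 ≤ t) {f : ℝ → ℝ} (hf : Integrable f gauss) (x : ℝ) :
    Integrable (fun y => f (Real.exp (-t) * x + Real.sqrt (1 - Real.exp (-2 * t)) * y)) gauss := by
  rcases ht.eq_or_lt with rfl | h
  · simp
  · exact integrable_comp_affine (sqrt_one_sub_exp_pos h) (exp_sq_add_sqrt_sq ht) hf x

lemma integrable_OU {t : ℝ} (ht : 0 ≤ t) {f : ℝ → ℝ} (hf : Integrable f gauss) :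
    Integrable (OU t f) gauss := integrable_mehler (exp_sq_add_sqrt_sq ht) hf

lemma integral_OU {t : ℝ} (ht : 0 ≤ t) {f : ℝ → ℝ} (hf : Integrable f gauss) :
    ∫ x, OU t f x ∂gauss = ∫ x, f x ∂gauss := integral_mehler (exp_sq_add_sqrt_sq ht) hf

lemma OU_OU {s t : ℝ} (hs : 0 ≤ s) (ht : 0 ≤ t) {f : ℝ → ℝ} (hf : Integrable f gauss) :
    OU s (OU t f) = OU (s + t) f := by
  rcases hs.eq_or_lt with rfl | hs'
  · rw [OU_zero, zero_add]
  have hst : 0 < s + t := by linarith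
  have e : Real.exp (-t) * Real.exp (-s) = Real.exp (-(s + t)) := by
    rw [← Real.exp_add]; ring_nf
  have h1 := exp_sq_add_sqrt_sq hst.le
  have h2 := exp_sq_add_sqrt_sq hs
  have h3 := exp_sq_add_sqrt_sq ht
  simp only [OU_eq_mehler]
  rw [mehler_mehler (sqrt_one_sub_exp_pos hst) (by rw [e]; exact h1) ?_ hf, e]
  rw [← e] at h1
  rw [mul_pow] at h1 ⊢
  have : Real.sqrt (1 - Real.exp (-2 * s)) ^ 2 = 1 - Real.exp (-s) ^ 2 := by linarith
  rw [this]
  linarith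

lemma OU_pos {t : ℝ} (ht : 0 ≤ t) {f : ℝ → ℝ} (hf : Integrable f gauss) (h : ∀ x, 0 < f x)
    (x : ℝ) : 0 < OU t f x := by
  refine (integral_pos_iff_support_of_nonneg (fun y => (h _).le) (integrable_comp_OU ht hf x)).2 ?_
  have : Function.support (fun y => f (Real.exp (-t) * x +
      Real.sqrt (1 - Real.exp (-2 * t)) * y)) = Set.univ := by
    ext y; simp [(h _).ne']
  rw [this]; simp

lemma contDiff_OU {t : ℝ} (ht : 0 ≤ t) {f : ℝ → ℝ} (hf : Integrable f gauss) (h : ∀ x, 0 < f x)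
    (hs : ContDiff ℝ (⊤ : ℕ∞) f) : ContDiff ℝ (⊤ : ℕ∞) (OU t f) := by
  rcases ht.eq_or_lt with rfl | ht'
  · rwa [OU_zero]
  · exact contDiff_mehler (Real.exp_pos _) (sqrt_one_sub_exp_pos ht') (exp_sq_add_sqrt_sq ht)
      (fun x => (h x).le) hs.continuous.measurable hf

lemma hasDerivAt_OU {t : ℝ} (ht : 0 ≤ t) {f f' : ℝ → ℝ} {c : ℝ} (hf0 : ∀ x, c ≤ f x)
    (hd : ∀ x, HasDerivAt f (f' x) x) (hf : Integrable f gauss) (hf' : Integrable f' gauss)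
    (x : ℝ) : HasDerivAt (OU t f) (Real.exp (-t) * OU t f' x) x := by
  rcases ht.eq_or_lt with rfl | ht'
  · simpa [OU_zero] using hd x
  · exact hasDerivAt_mehler (Real.exp_pos _) (sqrt_one_sub_exp_pos ht') (exp_sq_add_sqrt_sq ht)
      hf0 hd hf hf' x

lemma isDensityG_OU {t : ℝ} (ht : 0 ≤ t) {f : ℝ → ℝ} (hf : IsDensityG f) :
    IsDensityG (OU t f) :=
  ⟨OU_pos ht hf.2.2.1 hf.1, contDiff_OU ht hf.2.2.1 hf.1 hf.2.1, integrable_OU ht hf.2.2.1,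
    (integral_OU ht hf.2.2.1).trans hf.2.2.2⟩

/-- The Fisher information with respect to the Gaussian measure. -/
def fisherG (u : ℝ → ℝ) : ℝ := ∫ x, (deriv u x) ^ 2 / u x ∂gauss

/-- Smooth positive integrable functions with finite Fisher information. -/
structure FiniteFisher (g : ℝ → ℝ) : Prop where
  pos : ∀ x, 0 < g x
  smooth : ContDiff ℝ (⊤ : ℕ∞) g
  integrable : Integrable g gauss
  fisher : Integrable (fun x => (deriv g x) ^ 2 / g x) gauss

lemma fisherG_nonneg {u : ℝ → ℝ} (hu : ∀ x, 0 < u x) : 0 ≤ fisherG u :=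
  integral_nonneg fun x => div_nonneg (sq_nonneg _) (hu x).le

namespace FiniteFisher

variable {g : ℝ → ℝ}

lemma hasDerivAt (hg : FiniteFisher g) (x : ℝ) : HasDerivAt g (deriv g x) x :=
  (hg.smooth.differentiable (by simp) x).hasDerivAt

lemma continuous_deriv (hg : FiniteFisher g) : Continuous (deriv g) := hg.smooth.continuous_deriv (by simp)

lemma integrable_deriv (hg : FiniteFisher g) : Integrable (deriv g) gauss := by
  refine ((hg.fisher.add hg.integrable).mono' hg.continuous_deriv.aestronglyMeasurable
    (Eventually.of_forall fun x => ?_))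
  simp only [Pi.add_apply, Real.norm_eq_abs]
  have h := hg.pos x
  have e : (deriv g x) ^ 2 / g x + g x - |deriv g x| =
      ((|deriv g x| - g x) ^ 2 + |deriv g x| * g x) / g x := by
    rw [← sq_abs (deriv g x)]; field_simp; ring
  have : 0 ≤ ((|deriv g x| - g x) ^ 2 + |deriv g x| * g x) / g x := by positivity
  linarith

lemma deriv_OU (hg : FiniteFisher g) {t : ℝ} (ht : 0 ≤ t) (x : ℝ) :
    deriv (OU t g) x = Real.exp (-t) * OU t (deriv g) x :=
  (hasDerivAt_OU ht (fun x => (hg.pos x).le) hg.hasDerivAt hg.integrable hg.integrable_deriv x).deriv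

lemma sq_deriv_OU_div_le (hg : FiniteFisher g) {t : ℝ} (ht : 0 ≤ t) (x : ℝ) :
    (deriv (OU t g) x) ^ 2 / OU t g x ≤ OU t (fun x => (deriv g x) ^ 2 / g x) x := by
  set A := OU t (fun x => (deriv g x) ^ 2 / g x) x
  set B := OU t (deriv g) x
  set D := OU t g x
  have hD : 0 < D := OU_pos ht hg.integrable hg.pos x
  have key : ∀ l, 0 ≤ A - 2 * l * B + l ^ 2 * D := by
    intro l
    have iA := integrable_comp_OU ht hg.fisher x
    have iB := (integrable_comp_OU ht hg.integrable_deriv x).const_mul (2 * l)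
    have iD := (integrable_comp_OU ht hg.integrable x).const_mul (l ^ 2)
    have : A - 2 * l * B + l ^ 2 * D = ∫ y, (fun z => (deriv g z - l * g z) ^ 2 / g z)
        (Real.exp (-t) * x + Real.sqrt (1 - Real.exp (-2 * t)) * y) ∂gauss := by
      simp only [A, B, D, _root_.OU]
      rw [← integral_const_mul, ← integral_const_mul, ← integral_sub' iA iB,
        ← integral_add' (iA.sub iB) iD]
      congr 1
      ext y
      simp only [Pi.add_apply, Pi.sub_apply]
      generalize Real.exp (-t) * x + Real.sqrt (1 - Real.exp (-2 * t)) * y = z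
      have h := hg.pos z
      field_simp
      ring
    rw [this]
    exact integral_nonneg fun y => div_nonneg (sq_nonneg _) (hg.pos _).le
  have hBA : B ^ 2 / D ≤ A := by
    have e : A - 2 * (B / D) * B + (B / D) ^ 2 * D = A - B ^ 2 / D := by field_simp; ring
    linarith [key (B / D)]
  rw [hg.deriv_OU ht, mul_pow, mul_div_assoc]
  refine (mul_le_of_le_one_left (by positivity) ?_).trans hBA
  exact pow_le_one₀ (Real.exp_nonneg _) (Real.exp_le_one_iff.2 (by linarith))

lemma OU (hg : FiniteFisher g) {t : ℝ} (ht : 0 ≤ t) : FiniteFisher (OU t g) where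
  pos := OU_pos ht hg.integrable hg.pos
  smooth := contDiff_OU ht hg.integrable hg.pos hg.smooth
  integrable := integrable_OU ht hg.integrable
  fisher := by
    have hs := contDiff_OU ht hg.integrable hg.pos hg.smooth
    have hp := OU_pos ht hg.integrable hg.pos
    refine (integrable_OU ht hg.fisher).mono' ?_ (Eventually.of_forall fun x => ?_)
    · exact (((hs.continuous_deriv (by simp)).pow 2).div hs.continuous
        fun x => (hp x).ne').aestronglyMeasurable
    · rw [Real.norm_eq_abs, abs_of_nonneg (div_nonneg (sq_nonneg _) (hp x).le)]
      exact hg.sq_deriv_OU_div_le ht x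

lemma fisherG_OU_le (hg : FiniteFisher g) {t : ℝ} (ht : 0 ≤ t) : fisherG (_root_.OU t g) ≤ fisherG g := by
  unfold fisherG
  rw [← integral_OU ht hg.fisher]
  exact integral_mono (hg.OU ht).fisher (integrable_OU ht hg.fisher) (hg.sq_deriv_OU_div_le ht)

lemma antitoneOn_fisherG_OU (hg : FiniteFisher g) : AntitoneOn (fun t => fisherG (_root_.OU t g)) (Set.Ici 0) := by
  intro s hs t ht hst
  have : _root_.OU t g = _root_.OU (t - s) (_root_.OU s g) := by
    rw [OU_OU (by linarith) hs hg.integrable]; ring_nf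
  simp only
  rw [this]
  exact (hg.OU hs).fisherG_OU_le (by linarith)

end FiniteFisher

lemma integrable_id_gauss : Integrable (fun x : ℝ => x) gauss := by
  rw [gauss_eq]
  exact (memLp_id_gaussianReal 1).integrable le_rfl

lemma integrable_gauss_of_bounded {f : ℝ → ℝ} {M : ℝ} (hf : Continuous f)
    (hM : ∀ x, |f x| ≤ M) : Integrable f gauss :=
  (integrable_const M).mono' hf.aestronglyMeasurable (Eventually.of_forall hM)

lemma integrable_id_mul_of_bounded {f : ℝ → ℝ} {M : ℝ} (hf : Continuous f)
    (hM : ∀ x, |f x| ≤ M) : Integrable (fun x => x * f x) gauss :=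
  have h : ∀ᵐ x ∂gauss, ‖f x‖ ≤ M := Eventually.of_forall hM
  integrable_id_gauss.mul_bdd hf.aestronglyMeasurable h

lemma abs_OU_le {t M : ℝ} {f : ℝ → ℝ} (hM : ∀ x, |f x| ≤ M) (x : ℝ) : |OU t f x| ≤ M := by
  have h : ∀ᵐ y ∂gauss,
      ‖f (Real.exp (-t) * x + Real.sqrt (1 - Real.exp (-2 * t)) * y)‖ ≤ M :=
    Eventually.of_forall fun y => hM _
  exact (norm_integral_le_of_norm_le_const h).trans (by simp)

lemma continuous_uncurry_OU {f : ℝ → ℝ} {M : ℝ} (hf : Continuous f) (hM : ∀ x, |f x| ≤ M) :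
    Continuous fun p : ℝ × ℝ => OU p.1 f p.2 := by
  refine continuous_of_dominated (bound := fun _ => M) (fun p => ?_) (fun p => ?_)
    (integrable_const M) (Eventually.of_forall fun y => ?_)
  · exact (hf.comp (by fun_prop)).aestronglyMeasurable
  · exact Eventually.of_forall fun y => hM _
  · exact hf.comp (by fun_prop)

/-- The Ornstein–Uhlenbeck generator. -/
def genOU (ψ : ℝ → ℝ) (x : ℝ) : ℝ := deriv (deriv ψ) x - x * deriv ψ x

section TestFunction

variable {ψ : ℝ → ℝ}

lemma continuous_genOU (hψ : ContDiff ℝ (⊤ : ℕ∞) ψ) : Continuous (genOU ψ) := by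
  have h1 : ContDiff ℝ (⊤ : ℕ∞) (deriv ψ) := (contDiff_infty_iff_deriv.1 hψ).2
  have h2 : Continuous (deriv (deriv ψ)) := h1.continuous_deriv (by simp)
  unfold genOU
  exact h2.sub (continuous_id.mul h1.continuous)

lemma hasCompactSupport_genOU (hc : HasCompactSupport ψ) : HasCompactSupport (genOU ψ) :=
  hc.deriv.deriv.sub hc.deriv.mul_left

lemma exists_bounds (hψ : ContDiff ℝ (⊤ : ℕ∞) ψ) (hc : HasCompactSupport ψ) :
    ∃ M, (∀ x, |ψ x| ≤ M) ∧ (∀ x, |deriv ψ x| ≤ M) ∧ (∀ x, |deriv (deriv ψ) x| ≤ M) ∧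
      ∀ x, |genOU ψ x| ≤ M := by
  have h1 : ContDiff ℝ (⊤ : ℕ∞) (deriv ψ) := (contDiff_infty_iff_deriv.1 hψ).2
  have h2 : Continuous (deriv (deriv ψ)) := h1.continuous_deriv (by simp)
  obtain ⟨a, ha⟩ := hc.exists_bound_of_continuous hψ.continuous
  obtain ⟨b, hb⟩ := hc.deriv.exists_bound_of_continuous h1.continuous
  obtain ⟨c, hc'⟩ := hc.deriv.deriv.exists_bound_of_continuous h2
  obtain ⟨d, hd⟩ := (hasCompactSupport_genOU hc).exists_bound_of_continuous (continuous_genOU hψ)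
  refine ⟨max (max a b) (max c d), fun x => (ha x).trans ?_, fun x => (hb x).trans ?_,
    fun x => (hc' x).trans ?_, fun x => (hd x).trans ?_⟩ <;> simp

lemma integral_mul_deriv_comp_affine (hψ : ContDiff ℝ (⊤ : ℕ∞) ψ) (hc : HasCompactSupport ψ)
    (b σ : ℝ) : Integrable (fun y => y * deriv ψ (b + σ * y)) gauss ∧
      Integrable (fun y => deriv ψ (b + σ * y)) gauss ∧
      Integrable (fun y => deriv (deriv ψ) (b + σ * y)) gauss ∧
      ∫ y, y * deriv ψ (b + σ * y) ∂gauss = σ * ∫ y, deriv (deriv ψ) (b + σ * y) ∂gauss := by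
  obtain ⟨M, -, hM1, hM2, -⟩ := exists_bounds hψ hc
  have h1 : ContDiff ℝ (⊤ : ℕ∞) (deriv ψ) := (contDiff_infty_iff_deriv.1 hψ).2
  have h2 : Continuous (deriv (deriv ψ)) := h1.continuous_deriv (by simp)
  have i1 : Integrable (fun y => deriv ψ (b + σ * y)) gauss :=
    integrable_gauss_of_bounded (h1.continuous.comp (by fun_prop)) fun _ => hM1 _
  have i2 : Integrable (fun y => deriv (deriv ψ) (b + σ * y)) gauss :=
    integrable_gauss_of_bounded (h2.comp (by fun_prop)) fun _ => hM2 _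
  have i3 : Integrable (fun y => y * deriv ψ (b + σ * y)) gauss :=
    integrable_id_mul_of_bounded (h1.continuous.comp (by fun_prop)) fun _ => hM1 _
  have hd : ∀ y, HasDerivAt (fun y => deriv ψ (b + σ * y))
      (σ * deriv (deriv ψ) (b + σ * y)) y := by
    intro y
    have ha : HasDerivAt (fun y : ℝ => b + σ * y) σ y := by
      simpa using ((hasDerivAt_id y).const_mul σ).const_add b
    exact ((h1.differentiable (by simp) _).hasDerivAt.comp y ha).congr_deriv (mul_comm _ _)
  have := integral_deriv_sub_mul_eq_zero hd i1 ((i2.const_mul σ).sub i3)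
  rw [integral_sub (i2.const_mul σ) i3, integral_const_mul] at this
  exact ⟨i3, i1, i2, by linarith⟩

lemma OU_genOU (hψ : ContDiff ℝ (⊤ : ℕ∞) ψ) (hc : HasCompactSupport ψ) {t : ℝ} (ht : 0 ≤ t)
    (x : ℝ) : OU t (genOU ψ) x = Real.exp (-t) ^ 2 * OU t (deriv (deriv ψ)) x -
      x * (Real.exp (-t) * OU t (deriv ψ) x) := by
  have h := exp_sq_add_sqrt_sq ht
  simp only [OU]
  set a := Real.exp (-t)
  set σ := Real.sqrt (1 - Real.exp (-2 * t))
  obtain ⟨i3, i1, i2, he⟩ := integral_mul_deriv_comp_affine hψ hc (a * x) σ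
  have e : ∀ y, genOU ψ (a * x + σ * y) = deriv (deriv ψ) (a * x + σ * y) -
      (a * x * deriv ψ (a * x + σ * y) + σ * (y * deriv ψ (a * x + σ * y))) := by
    intro y; simp only [genOU]; ring
  have i4 : Integrable (fun y => a * x * deriv ψ (a * x + σ * y) +
      σ * (y * deriv ψ (a * x + σ * y))) gauss := (i1.const_mul _).add (i3.const_mul _)
  simp_rw [e]
  rw [integral_sub i2 i4,
    integral_add (i1.const_mul _) (i3.const_mul _), integral_const_mul, integral_const_mul, he]
  have : a ^ 2 = 1 - σ ^ 2 := by linarith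
  rw [this]; ring

lemma hasDerivAt_sqrt_one_sub_exp {t : ℝ} (ht : 0 < t) :
    HasDerivAt (fun t => Real.sqrt (1 - Real.exp (-2 * t)))
      (Real.exp (-2 * t) / Real.sqrt (1 - Real.exp (-2 * t))) t := by
  have h := sqrt_one_sub_exp_pos ht
  have h1 : HasDerivAt (fun t => 1 - Real.exp (-2 * t)) (2 * Real.exp (-2 * t)) t := by
    have h0 : HasDerivAt (fun t : ℝ => -2 * t) (-2) t := by
      simpa using (hasDerivAt_id t).const_mul (-2 : ℝ)
    refine (h0.exp.const_sub 1).congr_deriv (by ring)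
  refine (h1.sqrt (Real.sqrt_pos.1 h).ne').congr_deriv ?_
  field_simp

lemma hasDerivAt_OU_time (hψ : ContDiff ℝ (⊤ : ℕ∞) ψ) (hc : HasCompactSupport ψ) {t : ℝ}
    (ht : 0 < t) (x : ℝ) : HasDerivAt (fun t => OU t ψ x) (OU t (genOU ψ) x) t := by
  obtain ⟨M, hM, hM1, hM2, -⟩ := exists_bounds hψ hc
  have h1 : ContDiff ℝ (⊤ : ℕ∞) (deriv ψ) := (contDiff_infty_iff_deriv.1 hψ).2
  have hM0 : 0 ≤ M := (abs_nonneg _).trans (hM 0)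
  have hs := sqrt_one_sub_exp_pos (half_pos ht)
  set s := Real.sqrt (1 - Real.exp (-2 * (t / 2)))
  set F' : ℝ → ℝ → ℝ := fun t y =>
    deriv ψ (Real.exp (-t) * x + Real.sqrt (1 - Real.exp (-2 * t)) * y) *
      (-Real.exp (-t) * x + Real.exp (-2 * t) / Real.sqrt (1 - Real.exp (-2 * t)) * y)
  have key := (hasDerivAt_integral_of_dominated_loc_of_deriv_le (μ := gauss)
    (F := fun t y => ψ (Real.exp (-t) * x + Real.sqrt (1 - Real.exp (-2 * t)) * y))
    (F' := F') (x₀ := t) (bound := fun y => M * (|x| + s⁻¹ * |y|)) (Ioi_mem_nhds (half_lt_self ht))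
    (Eventually.of_forall fun r => (hψ.continuous.comp (by fun_prop)).aestronglyMeasurable)
    (integrable_gauss_of_bounded (hψ.continuous.comp (by fun_prop)) fun _ => hM _)
    (((h1.continuous.comp (by fun_prop)).mul (by fun_prop)).aestronglyMeasurable)
    (Eventually.of_forall fun y r hr => ?_)
    (((integrable_const _).add (integrable_id_gauss.abs.const_mul _)).const_mul M)
    (Eventually.of_forall fun y r hr => ?_)).2
  · refine key.congr_deriv ?_
    have hσ := sqrt_one_sub_exp_pos ht
    have h := exp_sq_add_sqrt_sq ht.le
    have ea : Real.exp (-2 * t) = Real.exp (-t) ^ 2 := by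
      rw [← Real.exp_nat_mul]; congr 1; push_cast; ring
    rw [OU_genOU hψ hc ht.le]
    simp only [F', OU]
    set σ := Real.sqrt (1 - Real.exp (-2 * t))
    rw [ea]
    set a := Real.exp (-t)
    obtain ⟨i3, i1, i2, he⟩ := integral_mul_deriv_comp_affine hψ hc (a * x) σ
    have e : ∀ y, deriv ψ (a * x + σ * y) * (-a * x + a ^ 2 / σ * y) =
      (-a * x) * deriv ψ (a * x + σ * y) + a ^ 2 / σ * (y * deriv ψ (a * x + σ * y)) := by
      intro y; ring
    simp_rw [e]
    rw [integral_add (i1.const_mul _) (i3.const_mul _), integral_const_mul, integral_const_mul, he]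
    field_simp
    ring
  · have hr0 : t / 2 < r := hr
    have hr1 : 0 < r := by linarith
    have hsr : s ≤ Real.sqrt (1 - Real.exp (-2 * r)) := by
      apply Real.sqrt_le_sqrt
      have : Real.exp (-2 * r) ≤ Real.exp (-2 * (t / 2)) := Real.exp_le_exp.2 (by linarith)
      linarith
    have b1 : Real.exp (-r) ≤ 1 := Real.exp_le_one_iff.2 (by linarith)
    have b2 : Real.exp (-2 * r) ≤ 1 := Real.exp_le_one_iff.2 (by linarith)
    have b3 : Real.exp (-2 * r) / Real.sqrt (1 - Real.exp (-2 * r)) ≤ s⁻¹ := by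
      rw [div_eq_mul_inv]
      calc _ ≤ 1 * s⁻¹ := by gcongr
        _ = _ := one_mul _
    rw [Real.norm_eq_abs, abs_mul]
    refine mul_le_mul (hM1 _) ?_ (abs_nonneg _) hM0
    refine (abs_add_le _ _).trans ?_
    rw [abs_mul, abs_mul, abs_neg, abs_of_pos (Real.exp_pos _), abs_of_nonneg (by positivity :
      0 ≤ Real.exp (-2 * r) / Real.sqrt (1 - Real.exp (-2 * r)))]
    gcongr
    exact mul_le_of_le_one_left (abs_nonneg _) b1
  · have hr0 : t / 2 < r := hr
    have hr1 : 0 < r := by linarith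
    have d1 : HasDerivAt (fun r : ℝ => Real.exp (-r) * x) (-Real.exp (-r) * x) r := by
      refine (((hasDerivAt_id r).neg.exp).mul_const x).congr_deriv ?_
      simp
    exact (hψ.differentiable (by simp) _).hasDerivAt.comp r
      (d1.add ((hasDerivAt_sqrt_one_sub_exp hr1).mul_const y))

lemma integral_OU_mul (hψ : Continuous ψ) (hc : HasCompactSupport ψ) {t : ℝ} (ht : 0 ≤ t)
    {f : ℝ → ℝ} (hf : Integrable f gauss) :
    ∫ x, OU t f x * ψ x ∂gauss = ∫ x, f x * OU t ψ x ∂gauss := by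
  rcases ht.eq_or_lt with rfl | ht'
  · simp [OU_zero]
  have hσ := sqrt_one_sub_exp_pos ht'
  have h := exp_sq_add_sqrt_sq ht
  simp only [OU_eq_mehler]
  set a := Real.exp (-t)
  set σ := Real.sqrt (1 - Real.exp (-2 * t))
  have hψi : Integrable ψ gauss := hψ.integrable_of_hasCompactSupport hc
  simp_rw [mehler_eq_integral_kernel hσ h hf, mehler_eq_integral_kernel hσ h hψi,
    ← integral_const_mul, ← integral_mul_const]
  rw [integral_integral_swap]
  · congr 1; ext z; congr 1; ext x
    rw [mehlerKernel_symm hσ h]; ring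
  · have hb : Continuous fun x => Real.exp (x ^ 2 / 2) * ψ x := by fun_prop
    obtain ⟨K, hK⟩ := (hc.mul_left (f := fun x => Real.exp (x ^ 2 / 2))).exists_bound_of_continuous hb
    refine ((hf.comp_snd gauss).const_mul (σ⁻¹ * K)).mono ?_ (Eventually.of_forall fun p => ?_)
    · refine ((continuous_mehlerKernel a σ).aestronglyMeasurable.mul
        (hf.comp_snd gauss).1).mul ?_
      exact (hψ.comp continuous_fst).aestronglyMeasurable
    · have hk := mehlerKernel_le (a := a) hσ p.1 p.2
      have hk0 := mehlerKernel_pos (a := a) hσ p.1 p.2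
      have hKp := hK p.1
      simp only [Function.uncurry, Real.norm_eq_abs, Pi.mul_apply, abs_mul, Real.abs_exp] at hKp ⊢
      have hK0 : 0 ≤ K := le_trans (by positivity) hKp
      rw [abs_of_pos hk0, abs_of_pos (inv_pos.2 hσ), abs_of_nonneg hK0]
      calc mehlerKernel a σ p.1 p.2 * |f p.2| * |ψ p.1|
          ≤ σ⁻¹ * Real.exp (p.1 ^ 2 / 2) * |f p.2| * |ψ p.1| := by gcongr
        _ = σ⁻¹ * (Real.exp (p.1 ^ 2 / 2) * |ψ p.1|) * |f p.2| := by ring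
        _ ≤ σ⁻¹ * K * |f p.2| := by gcongr

end TestFunction

section WeakEquation

variable {ψ f : ℝ → ℝ}

lemma continuous_integral_mul_OU (hf : Integrable f gauss) {M : ℝ} (hψ : Continuous ψ)
    (hM : ∀ x, |ψ x| ≤ M) : Continuous fun t => ∫ x, f x * OU t ψ x ∂gauss := by
  have hc := continuous_uncurry_OU hψ hM
  refine continuous_of_dominated (bound := fun x => |f x| * M) (fun t => ?_) (fun t => ?_)
    (hf.abs.mul_const M) (Eventually.of_forall fun x => ?_)
  · exact hf.1.mul (hc.comp (by fun_prop : Continuous fun x : ℝ => (t, x))).aestronglyMeasurable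
  · refine Eventually.of_forall fun x => ?_
    rw [norm_mul]
    exact mul_le_mul_of_nonneg_left (abs_OU_le hM x) (norm_nonneg _)
  · exact continuous_const.mul (hc.comp (by fun_prop : Continuous fun t : ℝ => (t, x)))

lemma hasDerivAt_integral_mul_OU (hf : Integrable f gauss) (hψ : ContDiff ℝ (⊤ : ℕ∞) ψ)
    (hc : HasCompactSupport ψ) {t : ℝ} (ht : 0 < t) :
    HasDerivAt (fun t => ∫ x, f x * OU t ψ x ∂gauss) (∫ x, f x * OU t (genOU ψ) x ∂gauss) t := by
  obtain ⟨M, hM, -, -, hM3⟩ := exists_bounds hψ hc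
  have c1 := continuous_uncurry_OU hψ.continuous hM
  have c2 := continuous_uncurry_OU (continuous_genOU hψ) hM3
  refine (hasDerivAt_integral_of_dominated_loc_of_deriv_le (μ := gauss)
    (F := fun t x => f x * OU t ψ x) (F' := fun t x => f x * OU t (genOU ψ) x)
    (bound := fun x => |f x| * M) (Ioi_mem_nhds ht)
    (Eventually.of_forall fun r => hf.1.mul
      (c1.comp (by fun_prop : Continuous fun x : ℝ => (r, x))).aestronglyMeasurable) ?_
    (hf.1.mul (c2.comp (by fun_prop : Continuous fun x : ℝ => (t, x))).aestronglyMeasurable)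
    (Eventually.of_forall fun x r _ => ?_) (hf.abs.mul_const M)
    (Eventually.of_forall fun x r hr => (hasDerivAt_OU_time hψ hc hr x).const_mul _)).2
  · refine hf.mul_bdd (c := M)
      (c1.comp (by fun_prop : Continuous fun x : ℝ => (t, x))).aestronglyMeasurable
      (Eventually.of_forall fun x => (Real.norm_eq_abs _).trans_le (abs_OU_le hM x))
  · rw [norm_mul]
    exact mul_le_mul_of_nonneg_left (abs_OU_le hM3 x) (norm_nonneg _)

lemma integral_deriv_mul_deriv {g : ℝ → ℝ} (hg : ContDiff ℝ (⊤ : ℕ∞) g)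
    (hψ : ContDiff ℝ (⊤ : ℕ∞) ψ) (hc : HasCompactSupport ψ) :
    ∫ x, deriv g x * deriv ψ x ∂gauss = -∫ x, g x * genOU ψ x ∂gauss := by
  have h1 : ContDiff ℝ (⊤ : ℕ∞) (deriv ψ) := (contDiff_infty_iff_deriv.1 hψ).2
  have hg' : Continuous (deriv g) := hg.continuous_deriv (by simp)
  have d : ∀ x, HasDerivAt (fun x => g x * deriv ψ x)
      (deriv g x * deriv ψ x + g x * deriv (deriv ψ) x) x := fun x =>
    (hg.differentiable (by simp) x).hasDerivAt.mul (h1.differentiable (by simp) x).hasDerivAt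
  have i1 : Integrable (fun x => deriv g x * deriv ψ x) gauss :=
    (hg'.mul h1.continuous).integrable_of_hasCompactSupport hc.deriv.mul_left
  have i2 : Integrable (fun x => g x * genOU ψ x) gauss :=
    (hg.continuous.mul (continuous_genOU hψ)).integrable_of_hasCompactSupport
      (hasCompactSupport_genOU hc).mul_left
  have i3 : Integrable (fun x => g x * deriv ψ x) gauss :=
    (hg.continuous.mul h1.continuous).integrable_of_hasCompactSupport hc.deriv.mul_left
  have e : (fun x => deriv g x * deriv ψ x + g x * deriv (deriv ψ) x - x * (g x * deriv ψ x)) =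
      fun x => deriv g x * deriv ψ x + g x * genOU ψ x := by
    ext x; unfold genOU; ring
  have := integral_deriv_sub_mul_eq_zero d i3 (by rw [e]; exact i1.add i2)
  rw [e, integral_add i1 i2] at this
  linarith

lemma integral_OU_mul_eq_add (hf : Integrable f gauss) (hψ : ContDiff ℝ (⊤ : ℕ∞) ψ)
    (hc : HasCompactSupport ψ) {t : ℝ} (ht : 0 ≤ t) :
    ∫ x, OU t f x * ψ x ∂gauss = ∫ x, f x * ψ x ∂gauss +
      ∫ r in (0 : ℝ)..t, ∫ x, f x * OU r (genOU ψ) x ∂gauss := by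
  obtain ⟨M, hM, -, -, hM3⟩ := exists_bounds hψ hc
  rw [intervalIntegral.integral_eq_sub_of_hasDerivAt_of_le ht
    (continuous_integral_mul_OU hf hψ.continuous hM).continuousOn
    (fun r hr => hasDerivAt_integral_mul_OU hf hψ hc hr.1)
    ((continuous_integral_mul_OU hf (continuous_genOU hψ) hM3).intervalIntegrable _ _),
    integral_OU_mul hψ.continuous hc ht hf, OU_zero]
  ring

lemma integral_mul_OU_genOU (hf : IsDensityG f) (hψ : ContDiff ℝ (⊤ : ℕ∞) ψ)
    (hc : HasCompactSupport ψ) {t : ℝ} (ht : 0 ≤ t) :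
    ∫ x, f x * OU t (genOU ψ) x ∂gauss = -∫ x, deriv (OU t f) x * deriv ψ x ∂gauss := by
  rw [integral_deriv_mul_deriv (isDensityG_OU ht hf).2.1 hψ hc, neg_neg,
    integral_OU_mul (continuous_genOU hψ) (hasCompactSupport_genOU hc) ht hf.2.2.1]

/-- A time reparametrization of the heat flow is an admissible path. -/
lemma isAdmissiblePathG_OU_comp (hf : IsDensityG f) {τ τ' : ℝ → ℝ} {T : ℝ}
    (h0 : τ 0 = 0) (h1 : τ 1 = T) (hτ : ∀ s ∈ Set.Icc (0 : ℝ) 1, 0 ≤ τ s)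
    (hd : ∀ s, HasDerivAt τ (τ' s) s) (hc : Continuous τ') :
    IsAdmissiblePathG f (OU T f) (fun s => OU (τ s) f) fun s x => -τ' s * OU (τ s) f x := by
  have hτc : Continuous τ := continuous_iff_continuousAt.2 fun s => (hd s).continuousAt
  refine ⟨fun s hs => isDensityG_OU (hτ s hs) hf,
    fun s hs => contDiff_const.mul (isDensityG_OU (hτ s hs) hf).2.1, by simp [h0, OU_zero],
    by simp [h1], fun ψ hψ hψc => ?_⟩
  obtain ⟨M, -, -, -, hM3⟩ := exists_bounds hψ hψc
  set B : ℝ → ℝ := fun r => ∫ x, f x * OU r (genOU ψ) x ∂gauss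
  have hB : Continuous B := continuous_integral_mul_OU hf.2.2.1 (continuous_genOU hψ) hM3
  have e : ∀ s ∈ Set.Icc (0 : ℝ) 1,
      ∫ x, deriv (fun x => -τ' s * OU (τ s) f x) x * deriv ψ x ∂gauss = B (τ s) * τ' s := by
    intro s hs
    have : ∀ x, deriv (fun x => -τ' s * OU (τ s) f x) x = -τ' s * deriv (OU (τ s) f) x :=
      fun x => deriv_const_mul _ ((isDensityG_OU (hτ s hs) hf).2.1.differentiable (by simp) x)
    simp_rw [this, mul_assoc]
    rw [integral_const_mul]
    simp only [B]
    rw [integral_mul_OU_genOU hf hψ hψc (hτ s hs)]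
    ring
  have hBτ : Continuous fun s => B (τ s) * τ' s := (hB.comp hτc).mul hc
  refine ⟨?_, fun s hs => ?_⟩
  · refine (hBτ.intervalIntegrable 0 1).congr fun s hs => ?_
    rw [Set.uIoc_of_le zero_le_one] at hs
    exact (e s ⟨hs.1.le, hs.2⟩).symm
  · have e2 : ∫ u in (0 : ℝ)..s, ∫ x, deriv (fun x => -τ' u * OU (τ u) f x) x * deriv ψ x ∂gauss =
        ∫ u in (0 : ℝ)..s, B (τ u) * τ' u := by
      refine intervalIntegral.integral_congr fun u hu => ?_
      rw [Set.uIcc_of_le hs.1] at hu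
      exact e u ⟨hu.1, hu.2.trans hs.2⟩
    have e3 := intervalIntegral.integral_comp_mul_deriv (a := 0) (b := s) (g := B)
      (fun u _ => hd u) hc.continuousOn hB
    simp only [Function.comp_def] at e3
    simp only [e2, h0, OU_zero, e3]
    exact integral_OU_mul_eq_add hf.2.2.1 hψ hψc (hτ s hs)

end WeakEquation

section Dissipation

variable {ψ : ℝ → ℝ}

lemma OU_one_add {M : ℝ} (hψ : Continuous ψ) (hM : ∀ x, |ψ x| ≤ M) (t x : ℝ) :
    OU t (fun x => 1 + ψ x) x = 1 + OU t ψ x := by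
  have i : Integrable (fun y => ψ (Real.exp (-t) * x + Real.sqrt (1 - Real.exp (-2 * t)) * y))
      gauss := integrable_gauss_of_bounded (hψ.comp (by fun_prop)) fun _ => hM _
  simp only [OU]
  rw [integral_add (integrable_const _) i]
  simp

lemma le_one_add_OU {c M : ℝ} (hψ : Continuous ψ) (hM : ∀ x, |ψ x| ≤ M)
    (h : ∀ x, c ≤ 1 + ψ x) (t x : ℝ) : 1 + OU t ψ x ∈ Set.Icc c (1 + M) := by
  refine ⟨?_, by linarith [(abs_le.1 (abs_OU_le (t := t) hM x)).2]⟩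
  rw [← OU_one_add hψ hM]
  calc c = ∫ _, c ∂gauss := by simp
    _ ≤ _ := integral_mono (integrable_const _) (integrable_gauss_of_bounded (M := 1 + M)
        (continuous_const.add (hψ.comp (by fun_prop))) fun y => ?_) fun y => h _
  exact (abs_add_le _ _).trans (by simpa using hM _)

lemma finiteFisher_one_add (hψ : ContDiff ℝ (⊤ : ℕ∞) ψ) (hc : HasCompactSupport ψ)
    (h : ∀ x, 0 < 1 + ψ x) : FiniteFisher fun x => 1 + ψ x := by
  have hs : ContDiff ℝ (⊤ : ℕ∞) fun x => 1 + ψ x := contDiff_const.add hψ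
  refine ⟨h, hs, (integrable_const _).add (hψ.continuous.integrable_of_hasCompactSupport hc), ?_⟩
  have hd : deriv (fun x => 1 + ψ x) = deriv ψ := by ext x; simp
  rw [hd]
  have h1 : Continuous (deriv ψ) := hψ.continuous_deriv (by simp)
  have hcs : HasCompactSupport fun x => deriv ψ x ^ 2 / (1 + ψ x) := by
    refine hc.deriv.mono fun x hx => ?_
    contrapose! hx
    simp [Function.notMem_support.1 hx]
  exact ((h1.pow 2).div hs.continuous fun x => (h x).ne').integrable_of_hasCompactSupport hcs

lemma integral_log_mul_OU_genOU (hψ : ContDiff ℝ (⊤ : ℕ∞) ψ) (hc : HasCompactSupport ψ)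
    {c : ℝ} (hc0 : 0 < c) (h : ∀ x, c ≤ 1 + ψ x) {t : ℝ} (ht : 0 ≤ t) :
    ∫ x, Real.log (1 + OU t ψ x) * OU t (genOU ψ) x ∂gauss =
      -fisherG (OU t fun x => 1 + ψ x) := by
  obtain ⟨M, hM, hM1, hM2, hM3⟩ := exists_bounds hψ hc
  have hM0 : 0 ≤ M := (abs_nonneg _).trans (hM 0)
  have h1 : ContDiff ℝ (⊤ : ℕ∞) (deriv ψ) := (contDiff_infty_iff_deriv.1 hψ).2
  have h2 : Continuous (deriv (deriv ψ)) := h1.continuous_deriv (by simp)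
  have hU := le_one_add_OU hψ.continuous hM h t
  have hg := finiteFisher_one_add hψ hc fun x => hc0.trans_le (h x)
  have hd : deriv (fun x => 1 + ψ x) = deriv ψ := by ext x; simp
  set V : ℝ → ℝ := fun x => Real.exp (-t) * OU t (deriv ψ) x with hV
  have dU : ∀ x, HasDerivAt (fun x => 1 + OU t ψ x) (V x) x := fun x =>
    (hasDerivAt_OU ht (fun x => (abs_le.1 (hM x)).1) (fun x =>
      (hψ.differentiable (by simp) x).hasDerivAt) (integrable_gauss_of_bounded hψ.continuous hM)
      (integrable_gauss_of_bounded h1.continuous hM1) x).const_add 1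
  have dV : ∀ x, HasDerivAt V (Real.exp (-t) ^ 2 * OU t (deriv (deriv ψ)) x) x := fun x =>
    ((hasDerivAt_OU ht (fun x => (abs_le.1 (hM1 x)).1) (fun x =>
      (h1.differentiable (by simp) x).hasDerivAt) (integrable_gauss_of_bounded h1.continuous hM1)
      (integrable_gauss_of_bounded h2 hM2) x).const_mul _).congr_deriv (by ring)
  have cU : Continuous fun x => 1 + OU t ψ x :=
    continuous_iff_continuousAt.2 fun x => (dU x).continuousAt
  have cV : Continuous V := continuous_iff_continuousAt.2 fun x => (dV x).continuousAt
  have cG : Continuous (OU t (genOU ψ)) := (continuous_uncurry_OU (continuous_genOU hψ) hM3).comp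
    (by fun_prop : Continuous fun x : ℝ => (t, x))
  have pU : ∀ x, 0 < 1 + OU t ψ x := fun x => hc0.trans_le (hU x).1
  have cL : Continuous fun x => Real.log (1 + OU t ψ x) := cU.log fun x => (pU x).ne'
  obtain ⟨L, hL⟩ := (isCompact_Icc (a := c) (b := 1 + M)).exists_bound_of_continuousOn
    (f := Real.log) (Real.continuousOn_log.mono fun x hx => (hc0.trans_le hx.1).ne')
  have bV : ∀ x, |V x| ≤ M := fun x => by
    rw [hV, abs_mul, Real.abs_exp]
    exact (mul_le_of_le_one_left (abs_nonneg _) (Real.exp_le_one_iff.2 (by linarith))).trans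
      (abs_OU_le hM1 x)
  have i1 : Integrable (fun x => Real.log (1 + OU t ψ x) * OU t (genOU ψ) x) gauss := by
    refine integrable_gauss_of_bounded (M := L * M) (cL.mul cG) fun x => ?_
    rw [abs_mul]
    exact mul_le_mul (hL _ (hU x)) (abs_OU_le hM3 x) (abs_nonneg _)
      ((norm_nonneg _).trans (hL _ (hU x)))
  have i2 : Integrable (fun x => Real.log (1 + OU t ψ x) * V x) gauss := by
    refine integrable_gauss_of_bounded (M := L * M) (cL.mul cV) fun x => ?_
    rw [abs_mul]
    exact mul_le_mul (hL _ (hU x)) (bV x) (abs_nonneg _) ((norm_nonneg _).trans (hL _ (hU x)))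
  have eU : ∀ x, deriv (OU t fun x => 1 + ψ x) x ^ 2 / OU t (fun x => 1 + ψ x) x =
      V x ^ 2 / (1 + OU t ψ x) := fun x => by
    rw [hg.deriv_OU ht, hd, OU_one_add hψ.continuous hM]
  have i3 : Integrable (fun x => V x ^ 2 / (1 + OU t ψ x)) gauss := by
    simpa only [eU] using (hg.OU ht).fisher
  have du : ∀ x, HasDerivAt (fun x => Real.log (1 + OU t ψ x) * V x)
      (V x / (1 + OU t ψ x) * V x +
        Real.log (1 + OU t ψ x) * (Real.exp (-t) ^ 2 * OU t (deriv (deriv ψ)) x)) x := fun x =>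
    ((dU x).log (pU x).ne').mul (dV x)
  have e : (fun x => V x / (1 + OU t ψ x) * V x +
        Real.log (1 + OU t ψ x) * (Real.exp (-t) ^ 2 * OU t (deriv (deriv ψ)) x) -
        x * (Real.log (1 + OU t ψ x) * V x)) =
      fun x => V x ^ 2 / (1 + OU t ψ x) + Real.log (1 + OU t ψ x) * OU t (genOU ψ) x := by
    ext x; rw [OU_genOU hψ hc ht]; simp only [V]; ring
  have := integral_deriv_sub_mul_eq_zero du i2 (by rw [e]; exact i3.add i1)
  rw [e, integral_add i3 i1] at this
  rw [fisherG]
  simp_rw [eU]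
  linarith

lemma integral_fisherG_OU_one_add_le (hψ : ContDiff ℝ (⊤ : ℕ∞) ψ) (hc : HasCompactSupport ψ)
    {c : ℝ} (hc0 : 0 < c) (h : ∀ x, c ≤ 1 + ψ x) {T : ℝ} (hT : 0 ≤ T) :
    ∫ t in (0 : ℝ)..T, fisherG (OU t fun x => 1 + ψ x) ≤ ∫ x, klFun (1 + ψ x) ∂gauss := by
  obtain ⟨M, hM, hM1, hM2, hM3⟩ := exists_bounds hψ hc
  have hU := le_one_add_OU hψ.continuous hM h
  have pU : ∀ t x, 0 < 1 + OU t ψ x := fun t x => hc0.trans_le (hU t x).1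
  obtain ⟨L, hL⟩ := (isCompact_Icc (a := c) (b := 1 + M)).exists_bound_of_continuousOn
    (f := Real.log) (Real.continuousOn_log.mono fun x hx => (hc0.trans_le hx.1).ne')
  obtain ⟨K, hK⟩ := (isCompact_Icc (a := c) (b := 1 + M)).exists_bound_of_continuousOn
    continuous_klFun.continuousOn
  have cU := continuous_const (y := (1 : ℝ)).add (continuous_uncurry_OU hψ.continuous hM)
  have cG := continuous_uncurry_OU (continuous_genOU hψ) hM3
  have cP : Continuous fun p : ℝ × ℝ => Real.log (1 + OU p.1 ψ p.2) * OU p.1 (genOU ψ) p.2 :=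
    (cU.log fun p => (pU p.1 p.2).ne').mul cG
  have cK : Continuous fun p : ℝ × ℝ => klFun (1 + OU p.1 ψ p.2) := continuous_klFun.comp cU
  have bP : ∀ t x, ‖Real.log (1 + OU t ψ x) * OU t (genOU ψ) x‖ ≤ L * M := fun t x => by
    rw [norm_mul]
    exact mul_le_mul (hL _ (hU t x)) (abs_OU_le hM3 x) (abs_nonneg _)
      ((norm_nonneg _).trans (hL _ (hU t x)))
  have cx : ∀ x : ℝ, Continuous fun t : ℝ => (t, x) := fun x => by fun_prop
  have ct : ∀ t : ℝ, Continuous fun x : ℝ => (t, x) := fun t => by fun_prop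
  have hN : Continuous fun t => ∫ x, klFun (1 + OU t ψ x) ∂gauss :=
    continuous_of_dominated (bound := fun _ => K)
      (fun t => (cK.comp (ct t)).aestronglyMeasurable)
      (fun t => Eventually.of_forall fun x => hK _ (hU t x)) (integrable_const K)
      (Eventually.of_forall fun x => cK.comp (cx x))
  have hD : Continuous fun t => ∫ x, Real.log (1 + OU t ψ x) * OU t (genOU ψ) x ∂gauss :=
    continuous_of_dominated (bound := fun _ => L * M)
      (fun t => (cP.comp (ct t)).aestronglyMeasurable)
      (fun t => Eventually.of_forall fun x => bP t x) (integrable_const _)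
      (Eventually.of_forall fun x => cP.comp (cx x))
  have dN : ∀ t ∈ Set.Ioo 0 T, HasDerivAt (fun t => ∫ x, klFun (1 + OU t ψ x) ∂gauss)
      (∫ x, Real.log (1 + OU t ψ x) * OU t (genOU ψ) x ∂gauss) t := fun t ht =>
    (hasDerivAt_integral_of_dominated_loc_of_deriv_le (μ := gauss)
      (F := fun t x => klFun (1 + OU t ψ x))
      (F' := fun t x => Real.log (1 + OU t ψ x) * OU t (genOU ψ) x)
      (bound := fun _ => L * M) (Ioi_mem_nhds ht.1)
      (Eventually.of_forall fun r => (cK.comp (ct r)).aestronglyMeasurable)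
      (integrable_gauss_of_bounded (cK.comp (ct t)) fun x => hK _ (hU t x))
      (cP.comp (ct t)).aestronglyMeasurable
      (Eventually.of_forall fun x r _ => bP r x) (integrable_const _)
      (Eventually.of_forall fun x r hr => HasDerivAt.comp (h₂ := klFun)
        (h := fun r => 1 + OU r ψ x) r (hasDerivAt_klFun (pU r x).ne') ((hasDerivAt_OU_time hψ hc hr x).const_add 1))).2
  have key := intervalIntegral.integral_eq_sub_of_hasDerivAt_of_le hT hN.continuousOn dN
    (hD.intervalIntegrable _ _)
  have e : ∫ t in (0 : ℝ)..T, ∫ x, Real.log (1 + OU t ψ x) * OU t (genOU ψ) x ∂gauss =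
      -∫ t in (0 : ℝ)..T, fisherG (OU t fun x => 1 + ψ x) := by
    rw [← intervalIntegral.integral_neg]
    refine intervalIntegral.integral_congr fun t ht => ?_
    rw [Set.uIcc_of_le hT] at ht
    exact integral_log_mul_OU_genOU hψ hc hc0 h ht.1
  have hT0 : 0 ≤ ∫ x, klFun (1 + OU T ψ x) ∂gauss :=
    integral_nonneg fun x => klFun_nonneg (pU T x).le
  simp only [OU_zero] at key
  linarith

end Dissipation

lemma exists_smooth_cutoff : ∃ χ : ℝ → ℝ, ContDiff ℝ (⊤ : ℕ∞) χ ∧ HasCompactSupport χ ∧ χ 0 = 1 ∧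
    ∀ x, χ x ∈ Set.Icc (0 : ℝ) 1 := by
  let χ : ContDiffBump (0 : ℝ) := ⟨1, 2, one_pos, one_lt_two⟩
  exact ⟨χ, χ.contDiff, χ.hasCompactSupport, χ.one_of_mem_closedBall (by simpa using χ.rIn_pos.le),
    fun x => ⟨χ.nonneg, χ.le_one⟩⟩

lemma FiniteFisher.intervalIntegrable_fisherG_OU {g : ℝ → ℝ} (hg : FiniteFisher g) {a b : ℝ}
    (ha : 0 ≤ a) (hb : 0 ≤ b) : IntervalIntegrable (fun t => fisherG (_root_.OU t g)) volume a b :=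
  (hg.antitoneOn_fisherG_OU.mono fun _ hx => (le_min ha hb).trans hx.1).intervalIntegrable

lemma FiniteFisher.ofReal_integral_fisherG_OU {g : ℝ → ℝ} (hg : FiniteFisher g) {T : ℝ}
    (hT : 0 ≤ T) : ENNReal.ofReal (∫ t in (0 : ℝ)..T, fisherG (_root_.OU t g)) =
      ∫⁻ t in Set.Ioc 0 T, ENNReal.ofReal (fisherG (_root_.OU t g)) := by
  rw [intervalIntegral.integral_of_le hT]
  refine ofReal_integral_eq_lintegral_ofReal (hg.intervalIntegrable_fisherG_OU le_rfl hT).1 ?_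
  filter_upwards [ae_restrict_mem measurableSet_Ioc] with t ht
  exact fisherG_nonneg (hg.OU ht.1.le).pos

lemma FiniteFisher.aemeasurable_fisherG_OU {g : ℝ → ℝ} (hg : FiniteFisher g) (T : ℝ) :
    AEMeasurable (fun t => ENNReal.ofReal (fisherG (_root_.OU t g)))
      (volume.restrict (Set.Ioc 0 T)) :=
  (aemeasurable_restrict_of_antitoneOn measurableSet_Ioc
    (hg.antitoneOn_fisherG_OU.mono fun _ hx => hx.1.le)).ennreal_ofReal

lemma FiniteFisher.ofReal_fisherG {g : ℝ → ℝ} (hg : FiniteFisher g) :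
    ENNReal.ofReal (fisherG g) = ∫⁻ x, ENNReal.ofReal (deriv g x ^ 2 / g x) ∂gauss :=
  ofReal_integral_eq_lintegral_ofReal hg.fisher
    (Eventually.of_forall fun x => div_nonneg (sq_nonneg _) (hg.pos x).le)

/-- The integral form of de Bruijn's inequality for the heat flow. -/
lemma FiniteFisher.integral_fisherG_OU_le {g : ℝ → ℝ} (hg : FiniteFisher g)
    (hk : Integrable (fun x => klFun (g x)) gauss) {T : ℝ} (hT : 0 ≤ T) :
    ∫ t in (0 : ℝ)..T, fisherG (_root_.OU t g) ≤ ∫ x, klFun (g x) ∂gauss := by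
  obtain ⟨χ, hχ, hχc, hχ0, hχ1⟩ := exists_smooth_cutoff
  obtain ⟨K, hK⟩ := hχc.deriv.exists_bound_of_continuous (hχ.continuous_deriv (by simp))
  have hK0 : 0 ≤ K := (norm_nonneg _).trans (hK 0)
  set r : ℕ → ℝ := fun n => 1 / ((n : ℝ) + 1)
  have hr : ∀ n, 0 < r n := fun n => by positivity
  have hr1 : ∀ n, r n ≤ 1 := fun n => by
    simp only [r]; rw [div_le_one (by positivity)]; linarith [Nat.cast_nonneg (α := ℝ) n]
  have hrt : Tendsto r atTop (𝓝 0) := tendsto_one_div_add_atTop_nhds_zero_nat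
  set ψ : ℕ → ℝ → ℝ := fun n x => χ (r n * x) * (g x - 1)
  have hψ : ∀ n, ContDiff ℝ (⊤ : ℕ∞) (ψ n) := fun n =>
    (hχ.comp (contDiff_const.mul contDiff_id)).mul (hg.smooth.sub contDiff_const)
  have hψc : ∀ n, HasCompactSupport (ψ n) := fun n =>
    (hχc.comp_homeomorph (Homeomorph.mulLeft₀ (r n) (hr n).ne')).mul_right
  have hψe : ∀ n x, 1 + ψ n x = χ (r n * x) * g x + (1 - χ (r n * x)) * 1 := fun n x => by
    simp only [ψ]; ring
  have hψ0 : ∀ n x, 0 < 1 + ψ n x := fun n x => by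
    rw [hψe]
    rcases (hχ1 (r n * x)).1.eq_or_lt with h | h
    · rw [← h]; norm_num
    · have := mul_pos h (hg.pos x)
      linarith [(hχ1 (r n * x)).2]
  have hψl : ∀ n, ∃ c, 0 < c ∧ ∀ x, c ≤ 1 + ψ n x := fun n => by
    obtain ⟨x₀, hx₀⟩ := (hψ n).continuous.exists_forall_le_of_hasCompactSupport (hψc n)
    exact ⟨1 + ψ n x₀, hψ0 n x₀, fun x => by linarith [hx₀ x]⟩
  have hF : ∀ n, FiniteFisher fun x => 1 + ψ n x := fun n =>
    finiteFisher_one_add (hψ n) (hψc n) (hψ0 n)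
  have hkl : ∀ n, ∫ x, klFun (1 + ψ n x) ∂gauss ≤ ∫ x, klFun (g x) ∂gauss := fun n => by
    refine integral_mono_of_nonneg (Eventually.of_forall fun x => klFun_nonneg (hψ0 n x).le) hk
      (Eventually.of_forall fun x => ?_)
    have h := hχ1 (r n * x)
    have hc := convexOn_klFun.2 (hg.pos x).le (zero_le_one' ℝ) h.1 (sub_nonneg.2 h.2) (by ring)
    simp only [smul_eq_mul, klFun_one, mul_zero, add_zero] at hc
    simp only [hψe]
    exact hc.trans (mul_le_of_le_one_left (klFun_nonneg (hg.pos x).le) h.2)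
  have hχt : ∀ x, Tendsto (fun n => χ (r n * x)) atTop (𝓝 1) := fun x => by
    have h1 : Tendsto (fun n => r n * x) atTop (𝓝 0) := by simpa using hrt.mul_const x
    have := (hχ.continuous.tendsto 0).comp h1
    rwa [hχ0] at this
  have hψt : ∀ x, Tendsto (fun n => 1 + ψ n x) atTop (𝓝 (g x)) := fun x => by
    have := ((hχt x).mul_const (g x - 1)).const_add 1
    simpa using this
  have hd : ∀ n x, deriv (fun x => 1 + ψ n x) x =
      deriv χ (r n * x) * r n * (g x - 1) + χ (r n * x) * deriv g x := fun n x => by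
    have d1 : HasDerivAt (fun x => r n * x) (r n) x := by
      simpa using (hasDerivAt_id x).const_mul (r n)
    have d2 := (hχ.differentiable (by simp) (r n * x)).hasDerivAt.comp x d1
    exact ((d2.mul ((hg.hasDerivAt x).sub_const 1)).const_add 1).deriv
  have hdt : ∀ x, Tendsto (fun n => deriv (fun x => 1 + ψ n x) x) atTop (𝓝 (deriv g x)) :=
    fun x => by
      simp_rw [hd]
      have h0 : Tendsto (fun n => deriv χ (r n * x) * r n) atTop (𝓝 0) :=
        squeeze_zero_norm (a := fun n => K * r n) (fun n => by
          rw [norm_mul, Real.norm_of_nonneg (hr n).le]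
          exact mul_le_mul_of_nonneg_right (hK _) (hr n).le) (by simpa using hrt.const_mul K)
      simpa using (h0.mul_const (g x - 1)).add ((hχt x).mul_const (deriv g x))
  have habs : ∀ n x, |χ (r n * x)| ≤ 1 := fun n x => by
    rw [abs_of_nonneg (hχ1 _).1]; exact (hχ1 _).2
  have hgi : Integrable (fun x => g x + 1) gauss := hg.integrable.add (integrable_const 1)
  have hgb : ∀ x, |g x - 1| ≤ g x + 1 := fun x =>
    abs_le.2 ⟨by linarith [hg.pos x], by linarith⟩
  have hb1 : ∀ n x, ‖1 + ψ n x‖ ≤ g x + 1 := fun n x => by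
    rw [Real.norm_of_nonneg (hψ0 n x).le, hψe]
    have h := hχ1 (r n * x)
    linarith [mul_le_of_le_one_left (hg.pos x).le h.2, h.1]
  have hb2 : ∀ n x, ‖deriv (fun x => 1 + ψ n x) x‖ ≤ K * (g x + 1) + |deriv g x| := fun n x => by
    rw [hd]
    refine (norm_add_le _ _).trans (add_le_add ?_ ?_)
    · rw [norm_mul, norm_mul, Real.norm_of_nonneg (hr n).le]
      refine mul_le_mul ?_ (hgb x) (norm_nonneg _) hK0
      exact (mul_le_of_le_one_right (norm_nonneg _) (hr1 n)).trans (hK _)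
    · rw [norm_mul]
      exact mul_le_of_le_one_left (norm_nonneg _) (habs n x)
  have hgi2 : Integrable (fun x => K * (g x + 1) + |deriv g x|) gauss :=
    (hgi.const_mul K).add hg.integrable_deriv.abs
  have ht1 : ∀ t, 0 ≤ t → ∀ x, Tendsto (fun n => _root_.OU t (fun x => 1 + ψ n x) x) atTop
      (𝓝 (_root_.OU t g x)) := fun t ht x =>
    tendsto_integral_of_dominated_convergence _
      (fun n => ((hF n).smooth.continuous.comp (by fun_prop)).aestronglyMeasurable)
      (integrable_comp_OU ht hgi x) (fun n => Eventually.of_forall fun y => hb1 n _)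
      (Eventually.of_forall fun y => hψt _)
  have ht2 : ∀ t, 0 ≤ t → ∀ x, Tendsto (fun n => _root_.OU t (deriv fun x => 1 + ψ n x) x) atTop
      (𝓝 (_root_.OU t (deriv g) x)) := fun t ht x =>
    tendsto_integral_of_dominated_convergence _
      (fun n => ((hF n).continuous_deriv.comp (by fun_prop)).aestronglyMeasurable)
      (integrable_comp_OU ht hgi2 x) (fun n => Eventually.of_forall fun y => hb2 n _)
      (Eventually.of_forall fun y => hdt _)
  have hliminf : ∀ t, 0 ≤ t → ENNReal.ofReal (fisherG (_root_.OU t g)) ≤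
      liminf (fun n => ENNReal.ofReal (fisherG (_root_.OU t fun x => 1 + ψ n x))) atTop := by
    intro t ht
    have hlim : ∀ x, Tendsto (fun n => ENNReal.ofReal (deriv (_root_.OU t fun x => 1 + ψ n x) x ^ 2 /
        _root_.OU t (fun x => 1 + ψ n x) x)) atTop
        (𝓝 (ENNReal.ofReal (deriv (_root_.OU t g) x ^ 2 / _root_.OU t g x))) := fun x => by
      refine ENNReal.tendsto_ofReal (Tendsto.div ?_ (ht1 t ht x) ((hg.OU ht).pos x).ne')
      simp_rw [(hF _).deriv_OU ht, hg.deriv_OU ht]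
      exact ((ht2 t ht x).const_mul _).pow 2
    rw [(hg.OU ht).ofReal_fisherG]
    simp_rw [((hF _).OU ht).ofReal_fisherG, ← fun x => (hlim x).liminf_eq]
    exact lintegral_liminf_le' fun n => ((hF n).OU ht).fisher.1.aemeasurable.ennreal_ofReal
  have hk0 : 0 ≤ ∫ x, klFun (g x) ∂gauss := integral_nonneg fun x => klFun_nonneg (hg.pos x).le
  rw [← ENNReal.ofReal_le_ofReal_iff hk0, hg.ofReal_integral_fisherG_OU hT]
  calc ∫⁻ t in Set.Ioc 0 T, ENNReal.ofReal (fisherG (_root_.OU t g))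
      ≤ ∫⁻ t in Set.Ioc 0 T, liminf (fun n =>
          ENNReal.ofReal (fisherG (_root_.OU t fun x => 1 + ψ n x))) atTop :=
        setLIntegral_mono' measurableSet_Ioc fun t ht => hliminf t ht.1.le
    _ ≤ liminf (fun n => ∫⁻ t in Set.Ioc 0 T,
          ENNReal.ofReal (fisherG (_root_.OU t fun x => 1 + ψ n x))) atTop :=
        lintegral_liminf_le' fun n => (hF n).aemeasurable_fisherG_OU T
    _ ≤ liminf (fun _ : ℕ => ENNReal.ofReal (∫ x, klFun (g x) ∂gauss)) atTop := by
        refine liminf_le_liminf (Eventually.of_forall fun n => ?_)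
        obtain ⟨c, hc0, hc⟩ := hψl n
        rw [← (hF n).ofReal_integral_fisherG_OU hT]
        exact ENNReal.ofReal_le_ofReal
          ((integral_fisherG_OU_one_add_le (hψ n) (hψc n) hc0 hc hT).trans (hkl n))
    _ = _ := by simp

lemma klFun_OU_le {f : ℝ → ℝ} (hf : FiniteFisher f) (hk : Integrable (fun x => klFun (f x)) gauss)
    {t : ℝ} (ht : 0 ≤ t) (x : ℝ) : klFun (OU t f x) ≤ OU t (fun x => klFun (f x)) x :=
  convexOn_klFun.map_integral_le continuous_klFun.continuousOn isClosed_Ici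
    (Eventually.of_forall fun _ => (hf.pos _).le) (integrable_comp_OU ht hf.integrable x)
    (integrable_comp_OU ht hk x)

lemma integrable_klFun_OU {f : ℝ → ℝ} (hf : FiniteFisher f)
    (hk : Integrable (fun x => klFun (f x)) gauss) {t : ℝ} (ht : 0 ≤ t) :
    Integrable (fun x => klFun (OU t f x)) gauss := by
  refine (integrable_OU ht hk).mono'
    (continuous_klFun.comp (hf.OU ht).smooth.continuous).aestronglyMeasurable
    (Eventually.of_forall fun x => ?_)
  rw [Real.norm_of_nonneg (klFun_nonneg ((hf.OU ht).pos x).le)]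
  exact klFun_OU_le hf hk ht x

lemma integral_fisherG_OU_tail_le {f : ℝ → ℝ} (hf : FiniteFisher f)
    (hk : Integrable (fun x => klFun (f x)) gauss) {t T : ℝ} (ht : 0 ≤ t) (htT : t ≤ T) :
    ∫ r in t..T, fisherG (OU r f) ≤ ∫ x, klFun (OU t f x) ∂gauss := by
  refine le_trans (le_of_eq ?_) ((hf.OU ht).integral_fisherG_OU_le (integrable_klFun_OU hf hk ht)
    (sub_nonneg.2 htT))
  have := intervalIntegral.integral_comp_add_right (a := 0) (b := T - t)
    (fun r => fisherG (OU r f)) t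
  rw [zero_add, sub_add_cancel] at this
  rw [← this]
  refine intervalIntegral.integral_congr fun r hr => ?_
  rw [Set.uIcc_of_le (sub_nonneg.2 htT)] at hr
  simp only [OU_OU hr.1 ht hf.integrable]

lemma integrable_klFun_iff {f : ℝ → ℝ} (hf : IsDensityG f) :
    Integrable (fun x => klFun (f x)) gauss ↔ Integrable (fun x => f x * Real.log (f x)) gauss := by
  have h : Integrable (fun x => 1 - f x) gauss := (integrable_const 1).sub hf.2.2.1
  have e : (fun x => klFun (f x)) = fun x => f x * Real.log (f x) + (1 - f x) := by
    ext x; rw [klFun_apply]; ring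
  rw [e]
  exact ⟨fun hi => (hi.sub h).congr (Eventually.of_forall fun x => by simp), fun hi => hi.add h⟩

lemma integral_klFun {f : ℝ → ℝ} (hf : IsDensityG f)
    (hi : Integrable (fun x => f x * Real.log (f x)) gauss) :
    ∫ x, klFun (f x) ∂gauss = entG f := by
  have h : Integrable (fun x => 1 - f x) gauss := (integrable_const 1).sub hf.2.2.1
  have e : (fun x => klFun (f x)) = fun x => f x * Real.log (f x) + (1 - f x) := by
    ext x; rw [klFun_apply]; ring
  rw [e, integral_add hi h, integral_sub (integrable_const 1) hf.2.2.1, hf.2.2.2, entG]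
  simp

lemma exists_time_change {w : ℝ → ℝ} {T : ℝ} (hT : 0 < T) (hw : ContinuousOn w (Set.Icc 0 T))
    (hpos : ∀ t ∈ Set.Icc 0 T, 0 < w t) :
    ∃ τ τ' : ℝ → ℝ, τ 0 = 0 ∧ τ 1 = T ∧ (∀ s ∈ Set.Icc (0 : ℝ) 1, τ s ∈ Set.Icc 0 T) ∧
      (∀ s, HasDerivAt τ (τ' s) s) ∧ Continuous τ' ∧
      ∀ s ∈ Set.Icc (0 : ℝ) 1, τ' s = (∫ t in (0 : ℝ)..T, w t) / w (τ s) := by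
  set v : ℝ → ℝ := fun t => w (max 0 (min t T))
  have hmem : ∀ t, max 0 (min t T) ∈ Set.Icc 0 T := fun t =>
    ⟨le_max_left _ _, max_le hT.le (min_le_right _ _)⟩
  have hvw : ∀ t ∈ Set.Icc 0 T, v t = w t := fun t ht => by
    simp only [v, min_eq_left ht.2, max_eq_right ht.1]
  have hv : Continuous v := hw.comp_continuous (by fun_prop) hmem
  have hv0 : ∀ t, 0 < v t := fun t => hpos _ (hmem t)
  obtain ⟨t₀, ht₀, hmin⟩ := isCompact_Icc.exists_isMinOn (Set.nonempty_Icc.2 hT.le) hw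
  have hm : ∀ t, w t₀ ≤ v t := fun t => hmin (hmem t)
  have hm0 : 0 < w t₀ := hpos t₀ ht₀
  set φ : ℝ → ℝ := fun t => ∫ r in (0 : ℝ)..t, v r
  have hφd : ∀ t, HasDerivAt φ (v t) t := fun t => hv.integral_hasStrictDerivAt 0 t |>.hasDerivAt
  have hφc : Continuous φ := continuous_iff_continuousAt.2 fun t => (hφd t).continuousAt
  have hφm : StrictMono φ := strictMono_of_deriv_pos fun t => by rw [(hφd t).deriv]; exact hv0 t
  have hsub : Monotone fun t => φ t - w t₀ * t := by
    have hd : ∀ t, HasDerivAt (fun t => φ t - w t₀ * t) (v t - w t₀) t := fun t => by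
      exact ((hφd t).sub ((hasDerivAt_id t).const_mul (w t₀))).congr_deriv (by rw [mul_one])
    refine monotone_of_deriv_nonneg (fun t => (hd t).differentiableAt) fun t => ?_
    rw [(hd t).deriv]; linarith [hm t]
  have hφ0 : φ 0 = 0 := intervalIntegral.integral_same
  have hlin : ∀ t, 0 ≤ t → w t₀ * t ≤ φ t := fun t ht => by
    have := hsub ht; simp only [hφ0] at this; linarith
  have hlin' : ∀ t, t ≤ 0 → φ t ≤ w t₀ * t := fun t ht => by
    have := hsub ht; simp only [hφ0] at this; linarith
  have hsurj : Function.Surjective φ := hφc.surjective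
    (tendsto_atTop_mono' _ ((eventually_ge_atTop 0).mono hlin) (tendsto_id.const_mul_atTop hm0))
    (tendsto_atBot_mono' _ ((eventually_le_atBot 0).mono hlin') (tendsto_id.const_mul_atBot hm0))
  set e := hφm.orderIsoOfSurjective φ hsurj
  have he : ∀ y, φ (e.symm y) = y := fun y => e.apply_symm_apply y
  have he' : ∀ t, e.symm (φ t) = t := fun t => e.symm_apply_apply t
  have hec : Continuous e.symm := e.symm.continuous
  have hed : ∀ y, HasDerivAt e.symm (v (e.symm y))⁻¹ y := fun y =>
    HasDerivAt.of_local_left_inverse hec.continuousAt (hφd _) (hv0 _).ne' (Eventually.of_forall he)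
  set D := φ T
  have hD : D = ∫ t in (0 : ℝ)..T, w t := intervalIntegral.integral_congr fun t ht => by
    rw [Set.uIcc_of_le hT.le] at ht; exact hvw t ht
  have hD0 : 0 < D := hφ0 ▸ hφm hT
  have hrange : ∀ s ∈ Set.Icc (0 : ℝ) 1, e.symm (D * s) ∈ Set.Icc 0 T := fun s hs => by
    rw [← he' T, ← he' 0, hφ0]
    exact ⟨e.symm.monotone (mul_nonneg hD0.le hs.1),
      e.symm.monotone (mul_le_of_le_one_right hD0.le hs.2)⟩
  refine ⟨fun s => e.symm (D * s), fun s => D / v (e.symm (D * s)), ?_, ?_, hrange, fun s => ?_, ?_,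
    fun s hs => ?_⟩
  · simp only [mul_zero]
    have := he' 0
    rwa [hφ0] at this
  · simp only [mul_one]; exact he' T
  · have h1 : HasDerivAt (fun s => D * s) D s := by simpa using (hasDerivAt_id s).const_mul D
    exact ((hed (D * s)).comp s h1).congr_deriv (inv_mul_eq_div _ _)
  · exact continuous_const.div (hv.comp (hec.comp (by fun_prop))) fun s => (hv0 _).ne'
  · simp only
    rw [hvw _ (hrange s hs), ← hD]

lemma exists_time_change_of_integral_le {I : ℝ → ℝ} {C T : ℝ} (hC : 0 < C) (hT : 0 < T)
    (hI : AntitoneOn I (Set.Ici 0)) (hI0 : ∀ t, 0 ≤ t → 0 ≤ I t)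
    (hle : ∀ t ∈ Set.Icc 0 T, ∫ r in t..T, I r ≤ C * I t) {ε : ℝ} (hε : 0 < ε) :
    ∃ τ τ' : ℝ → ℝ, τ 0 = 0 ∧ τ 1 = T ∧ (∀ s ∈ Set.Icc (0 : ℝ) 1, τ s ∈ Set.Icc 0 T) ∧
      (∀ s, HasDerivAt τ (τ' s) s) ∧ Continuous τ' ∧
      ∀ s ∈ Set.Icc (0 : ℝ) 1, τ' s ^ 2 * I (τ s) ≤
        4 * ((∫ r in (0 : ℝ)..T, I r) + ε ^ 2 * I 0 + C * ε) *
          (C + ε * I 0 * Real.exp (T / C)) := by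
  set F : ℝ → ℝ := fun r => I (max r 0)
  have hFa : Antitone F := fun a b hab => hI (Set.mem_Ici.2 (le_max_right a 0)) (Set.mem_Ici.2 (le_max_right b 0))
    (max_le_max hab le_rfl)
  have hF0 : ∀ r, 0 ≤ F r := fun r => hI0 _ (le_max_right _ _)
  have hFB : ∀ r, F r ≤ I 0 := fun r => hI Set.self_mem_Ici (Set.mem_Ici.2 (le_max_right r 0)) (le_max_right _ _)
  have hFI : ∀ r, 0 ≤ r → F r = I r := fun r hr => by simp only [F, max_eq_left hr]
  have hFi : ∀ a b, IntervalIntegrable F volume a b := fun a b => hFa.intervalIntegrable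
  set B := I 0
  have hB0 : 0 ≤ B := hI0 0 le_rfl
  set P : ℝ → ℝ := fun t => ∫ r in (0 : ℝ)..t, F r
  have hPc : Continuous P := intervalIntegral.continuous_primitive hFi 0
  have hPs : ∀ a b, P b - P a = ∫ r in a..b, F r := fun a b =>
    intervalIntegral.integral_interval_sub_left (hFi _ _) (hFi _ _)
  have hPm : Monotone P := fun a b hab => by
    have := intervalIntegral.integral_nonneg (μ := volume) hab fun r _ => hF0 r
    linarith [hPs a b]
  set Q : ℝ → ℝ := fun t => ∫ r in (0 : ℝ)..t, P r
  have hQd : ∀ t, HasDerivAt Q (P t) t := fun t => (hPc.integral_hasStrictDerivAt 0 t).hasDerivAt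
  have hQs : ∀ a b, Q b - Q a = ∫ r in a..b, P r := fun a b =>
    intervalIntegral.integral_interval_sub_left (hPc.intervalIntegrable _ _)
      (hPc.intervalIntegrable _ _)
  set A := ∫ r in (0 : ℝ)..T, I r
  have hAP : A = P T := intervalIntegral.integral_congr fun r hr => by
    rw [Set.uIcc_of_le hT.le] at hr; exact (hFI r hr.1).symm
  set η := ε ^ 2
  have hη : 0 < η := by positivity
  set M : ℝ → ℝ := fun t => A - η⁻¹ * (Q t - Q (t - η))
  set K : ℝ → ℝ := fun t => η⁻¹ * (P t - P (t - η))
  have hMd : ∀ t, HasDerivAt M (-K t) t := fun t =>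
    ((((hQd t).sub ((hQd (t - η)).comp_sub_const t η)).const_mul η⁻¹).const_sub A)
  have hPK : ∀ t, P t - P (t - η) ≤ η * B := fun t => by
    rw [hPs]
    calc _ ≤ ∫ _ in (t - η)..t, B := intervalIntegral.integral_mono (by linarith) (hFi _ _)
          intervalIntegrable_const fun r => hFB r
      _ = _ := by simp
  have hKI : ∀ t, 0 ≤ t → I t ≤ K t := fun t ht => by
    have : η * F t ≤ P t - P (t - η) := by
      rw [hPs]
      calc η * F t = ∫ _ in (t - η)..t, F t := by simp
        _ ≤ _ := intervalIntegral.integral_mono_on (by linarith) intervalIntegrable_const (hFi _ _)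
          fun r hr => hFa hr.2
    rw [hFI t ht] at this
    simp only [K]
    rwa [← div_eq_inv_mul, le_div_iff₀ hη, mul_comm]
  have hQl : ∀ t, P (t - η) ≤ η⁻¹ * (Q t - Q (t - η)) := fun t => by
    rw [← div_eq_inv_mul, le_div_iff₀ hη, hQs]
    calc P (t - η) * η = ∫ _ in (t - η)..t, P (t - η) := by simp [mul_comm]
      _ ≤ _ := intervalIntegral.integral_mono_on (by linarith) intervalIntegrable_const
        (hPc.intervalIntegrable _ _) fun r hr => hPm hr.1
  have hQu : ∀ t, η⁻¹ * (Q t - Q (t - η)) ≤ P t := fun t => by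
    rw [← div_eq_inv_mul, div_le_iff₀ hη, hQs]
    calc _ ≤ ∫ _ in (t - η)..t, P t := intervalIntegral.integral_mono_on (by linarith)
          (hPc.intervalIntegrable _ _) intervalIntegrable_const fun r hr => hPm hr.2
      _ = P t * η := by simp [mul_comm]
  have hM0 : ∀ t ∈ Set.Icc 0 T, 0 ≤ M t := fun t ht => by
    simp only [M]; linarith [hQu t, hPm ht.2]
  have hMu : ∀ t, M t ≤ A - P t + η * B := fun t => by
    simp only [M]; linarith [hQl t, hPK t]
  have hMK : ∀ t ∈ Set.Icc 0 T, M t ≤ C * K t + η * B := fun t ht => by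
    have h1 : A - P t = ∫ r in t..T, I r := by
      rw [hAP, hPs]
      refine intervalIntegral.integral_congr fun r hr => ?_
      rw [Set.uIcc_of_le ht.2] at hr
      exact hFI r (ht.1.trans hr.1)
    have h2 := mul_le_mul_of_nonneg_left (hKI t ht.1) hC.le
    linarith [hMu t, hle t ht]
  set E : ℝ → ℝ := fun t => ε * Real.exp (-t / C)
  have hE0 : ∀ t, 0 < E t := fun t => by positivity
  have hEd : ∀ t, HasDerivAt (fun t => C * E t) (-E t) t := fun t => by
    have h1 : HasDerivAt (fun t : ℝ => -t / C) (-1 / C) t := (hasDerivAt_id t).neg.div_const C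
    refine ((h1.exp.const_mul ε).const_mul C).congr_deriv ?_
    simp only [E]; field_simp
  set G : ℝ → ℝ := fun t => M t + C * E t
  set J : ℝ → ℝ := fun t => K t + E t
  have hGd : ∀ t, HasDerivAt G (-J t) t := fun t =>
    ((hMd t).add (hEd t)).congr_deriv (by simp only [J]; ring)
  have hG0 : ∀ t ∈ Set.Icc 0 T, 0 < G t := fun t ht =>
    add_pos_of_nonneg_of_pos (hM0 t ht) (mul_pos hC (hE0 t))
  have hJ0 : ∀ t ∈ Set.Icc 0 T, 0 < J t := fun t ht =>
    add_pos_of_nonneg_of_pos ((hI0 t ht.1).trans (hKI t ht.1)) (hE0 t)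
  have hIJ : ∀ t ∈ Set.Icc 0 T, I t ≤ J t := fun t ht => by
    simp only [J]; linarith [hKI t ht.1, hE0 t]
  have hGJ : ∀ t ∈ Set.Icc 0 T, G t ≤ (C + ε * B * Real.exp (T / C)) * J t := fun t ht => by
    have h1 : ε ≤ Real.exp (T / C) * J t := by
      calc ε = Real.exp (T / C) * (ε * Real.exp (-T / C)) := by
            rw [mul_left_comm, ← Real.exp_add]; simp [neg_div]
        _ ≤ Real.exp (T / C) * E t := by
            simp only [E]; gcongr; exact ht.2
        _ ≤ Real.exp (T / C) * J t := by
            gcongr; simp only [J]; linarith [(hI0 t ht.1).trans (hKI t ht.1)]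
    have h2 : η * B ≤ ε * B * Real.exp (T / C) * J t := by
      calc η * B = ε * B * ε := by simp only [η]; ring
        _ ≤ ε * B * (Real.exp (T / C) * J t) := by gcongr
        _ = _ := by ring
    simp only [G]
    have h3 : C * J t = C * K t + C * E t := by simp only [J]; ring
    linarith [hMK t ht]
  have hKc : Continuous K := continuous_const.mul (hPc.sub (hPc.comp (by fun_prop)))
  have hJc : Continuous J := hKc.add (by fun_prop)
  have hGc : Continuous G := continuous_iff_continuousAt.2 fun t => (hGd t).continuousAt
  have hwc : ContinuousOn (fun t => J t / (2 * √(G t))) (Set.Icc 0 T) :=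
    hJc.continuousOn.div (by fun_prop) fun t ht => by
      have := Real.sqrt_pos.2 (hG0 t ht); positivity
  obtain ⟨τ, τ', h0, h1, hr, hd, hc, hτ⟩ := exists_time_change hT hwc fun t ht =>
    div_pos (hJ0 t ht) (mul_pos two_pos (Real.sqrt_pos.2 (hG0 t ht)))
  refine ⟨τ, τ', h0, h1, hr, hd, hc, fun s hs => ?_⟩
  have hint : ∫ t in (0 : ℝ)..T, J t / (2 * √(G t)) = √(G 0) - √(G T) := by
    rw [intervalIntegral.integral_eq_sub_of_hasDerivAt (f := fun t => -√(G t))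
      (fun t ht => ?_) (hwc.intervalIntegrable_of_Icc hT.le)]
    · ring
    · rw [Set.uIcc_of_le hT.le] at ht
      exact ((hGd t).sqrt (hG0 t ht).ne').neg.congr_deriv (by ring)
  have hGT : √(G T) ≤ √(G 0) := by
    have : 0 ≤ ∫ t in (0 : ℝ)..T, J t / (2 * √(G t)) :=
      intervalIntegral.integral_nonneg hT.le fun t ht =>
        div_nonneg (hJ0 t ht).le (mul_nonneg two_pos.le (Real.sqrt_nonneg _))
    linarith
  have hD : (√(G 0) - √(G T)) ^ 2 ≤ G 0 := by
    calc _ ≤ √(G 0) ^ 2 := pow_le_pow_left₀ (sub_nonneg.2 hGT)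
          (by linarith [Real.sqrt_nonneg (G T)]) 2
      _ = G 0 := Real.sq_sqrt (hG0 0 ⟨le_rfl, hT.le⟩).le
  have hG00 : G 0 ≤ A + η * B + C * ε := by
    have := hMu 0
    have hP0 : P 0 = 0 := intervalIntegral.integral_same
    simp only [G, E]
    simp only [neg_zero, zero_div, Real.exp_zero, mul_one]
    linarith
  rw [hτ s hs, hint]
  have ht := hr s hs
  set t := τ s
  have hJt := hJ0 t ht
  have hGt := hG0 t ht
  have hsq : √(G t) ^ 2 = G t := Real.sq_sqrt hGt.le
  set δ := C + ε * B * Real.exp (T / C)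
  have hδ : 0 ≤ δ := by positivity
  calc ((√(G 0) - √(G T)) / (J t / (2 * √(G t)))) ^ 2 * I t
      = 4 * (√(G 0) - √(G T)) ^ 2 * (G t * I t / J t ^ 2) := by
        rw [div_div_eq_mul_div, div_pow, mul_pow, mul_pow, hsq]; ring
    _ ≤ 4 * G 0 * δ := by
        have : G t * I t / J t ^ 2 ≤ δ := by
          rw [div_le_iff₀ (by positivity)]
          calc G t * I t ≤ (δ * J t) * J t :=
                mul_le_mul (hGJ t ht) (hIJ t ht) (hI0 t ht.1) (by positivity)
            _ = _ := by ring
        have hG' : 0 ≤ 4 * G 0 := by linarith [hG0 0 ⟨le_rfl, hT.le⟩]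
        have hI' := hI0 t ht.1
        gcongr
    _ ≤ _ := by gcongr

lemma exists_time_change_near {I : ℝ → ℝ} {C T : ℝ} (hC : 0 < C) (hT : 0 < T)
    (hI : AntitoneOn I (Set.Ici 0)) (hI0 : ∀ t, 0 ≤ t → 0 ≤ I t)
    (hle : ∀ t ∈ Set.Icc 0 T, ∫ r in t..T, I r ≤ C * I t) {b : ℝ}
    (hb : 4 * C * (∫ r in (0 : ℝ)..T, I r) < b) :
    ∃ τ τ' : ℝ → ℝ, τ 0 = 0 ∧ τ 1 = T ∧ (∀ s ∈ Set.Icc (0 : ℝ) 1, τ s ∈ Set.Icc 0 T) ∧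
      (∀ s, HasDerivAt τ (τ' s) s) ∧ Continuous τ' ∧
      ∀ s ∈ Set.Icc (0 : ℝ) 1, τ' s ^ 2 * I (τ s) ≤ b := by
  set A := ∫ r in (0 : ℝ)..T, I r
  have hc : Continuous fun ε => 4 * (A + ε ^ 2 * I 0 + C * ε) *
      (C + ε * I 0 * Real.exp (T / C)) := by fun_prop
  have ht := (hc.tendsto 0).mono_left (nhdsWithin_le_nhds (s := Set.Ioi 0))
  have hlt := ht.eventually_lt_const (u := b) (by
    refine lt_of_eq_of_lt ?_ hb; ring)
  obtain ⟨ε, hεb, hε⟩ := (hlt.and self_mem_nhdsWithin).exists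
  obtain ⟨τ, τ', h0, h1, hr, hd, hc, hτ⟩ := exists_time_change_of_integral_le hC hT hI hI0 hle hε
  exact ⟨τ, τ', h0, h1, hr, hd, hc, fun s hs => (hτ s hs).trans hεb.le⟩

lemma IsDensityG.finiteFisher {f : ℝ → ℝ} (hf : IsDensityG f)
    (hi : Integrable (fun x => (deriv f x) ^ 2 / f x) gauss) : FiniteFisher f :=
  ⟨hf.1, hf.2.1, hf.2.2.1, hi⟩

lemma T2sqG_OU_le {f : ℝ → ℝ} (hf : IsDensityG f) (hF : FiniteFisher f) {τ τ' : ℝ → ℝ} {T b : ℝ}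
    (h0 : τ 0 = 0) (h1 : τ 1 = T) (hτ : ∀ s ∈ Set.Icc (0 : ℝ) 1, 0 ≤ τ s)
    (hd : ∀ s, HasDerivAt τ (τ' s) s) (hc : Continuous τ')
    (hb : ∀ s ∈ Set.Icc (0 : ℝ) 1, τ' s ^ 2 * fisherG (OU (τ s) f) ≤ b) :
    T2sqG f (OU T f) ≤ ENNReal.ofReal b := by
  unfold T2sqG
  refine sInf_le_of_le ⟨_, _, isAdmissiblePathG_OU_comp hf h0 h1 hτ hd hc, rfl⟩ ?_
  calc _ ≤ ∫⁻ _ in Set.Icc (0 : ℝ) 1, ENNReal.ofReal b :=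
        setLIntegral_mono' measurableSet_Icc fun s hs => ?_
    _ = _ := by simp
  have hF' := hF.OU (hτ s hs)
  have e : ∀ x, deriv (fun x => -τ' s * OU (τ s) f x) x ^ 2 / OU (τ s) f x =
      τ' s ^ 2 * (deriv (OU (τ s) f) x ^ 2 / OU (τ s) f x) := fun x => by
    rw [deriv_const_mul _ (hF'.smooth.differentiable (by simp) x)]; ring
  simp_rw [e, ENNReal.ofReal_mul (sq_nonneg (τ' s))]
  rw [lintegral_const_mul' _ _ ENNReal.ofReal_ne_top, ← hF'.ofReal_fisherG,
    ← ENNReal.ofReal_mul (sq_nonneg _)]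
  exact ENNReal.ofReal_le_ofReal (hb s hs)

theorem T2_talagrand_from_logSobolev
    (C : ℝ) (hC : 0 < C)
    (hLSI : ∀ u : ℝ → ℝ, IsDensityG u →
      Integrable (fun x => (deriv u x) ^ 2 / u x) gauss →
      entG u ≤ C * ∫ x, (deriv u x) ^ 2 / u x ∂gauss)
    (f : ℝ → ℝ) (hf : IsDensityG f)
    (hent : Integrable (fun x => f x * Real.log (f x)) gauss)
    (hfisher : Integrable (fun x => (deriv f x) ^ 2 / f x) gauss) :
    ∀ T ≥ (0:ℝ), T2sqG f (OU T f) ≤ ENNReal.ofReal (4 * C * entG f) := by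
  intro T hT
  have hF := hf.finiteFisher hfisher
  have hk := (integrable_klFun_iff hf).2 hent
  rcases hT.eq_or_lt with rfl | hT
  · refine T2sqG_OU_le hf hF (τ := fun _ => 0) (τ' := fun _ => 0) rfl rfl (fun _ _ => le_rfl)
      (fun s => hasDerivAt_const s 0) continuous_const fun s _ => ?_
    rw [← integral_klFun hf hent]
    have : 0 ≤ ∫ x, klFun (f x) ∂gauss := integral_nonneg fun x => klFun_nonneg (hf.1 x).le
    simp only [ne_eq, OfNat.ofNat_ne_zero, not_false_eq_true, zero_pow, zero_mul]
    positivity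
  have hI0 : ∀ t, 0 ≤ t → 0 ≤ fisherG (OU t f) := fun t ht => fisherG_nonneg (hF.OU ht).pos
  have hle : ∀ t ∈ Set.Icc 0 T, ∫ r in t..T, fisherG (OU r f) ≤ C * fisherG (OU t f) := by
    intro t ht
    have hft := isDensityG_OU ht.1 hf
    refine (integral_fisherG_OU_tail_le hF hk ht.1 ht.2).trans ?_
    rw [integral_klFun hft ((integrable_klFun_iff hft).1 (integrable_klFun_OU hF hk ht.1))]
    exact hLSI _ hft (hF.OU ht.1).fisher
  have htot : ∫ r in (0 : ℝ)..T, fisherG (OU r f) ≤ entG f := by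
    simpa only [OU_zero, integral_klFun hf hent] using
      integral_fisherG_OU_tail_le hF hk le_rfl hT.le
  refine ENNReal.le_of_forall_pos_le_add fun ε hε _ => ?_
  have hε' : (0 : ℝ) < ε := hε
  obtain ⟨τ, τ', h0, h1, hr, hd, hc, hτ⟩ := exists_time_change_near hC hT
    hF.antitoneOn_fisherG_OU hI0 hle (b := 4 * C * entG f + ε) (by
      have := mul_le_mul_of_nonneg_left htot (by positivity : 0 ≤ 4 * C)
      linarith)
  refine (T2sqG_OU_le hf hF h0 h1 (fun s hs => (hr s hs).1) hd hc hτ).trans ?_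
  refine ENNReal.ofReal_add_le.trans ?_
  simp

end
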